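/- arXiv:2507.13986 — 3 statements merged into one kernel-verified Lean document; each statement's English description precedes it below -/
import Mathlib

section
/- Let k ∈ ℝ and q ∈ ℝ. Let x₁, x₂ : ℂ → ℂ be differentiable in a neighborhood of a point t₀ ∈ ℂ with x₁'(t₀) + i·x₂'(t₀) = 0. Let U : ℂ² → ℂ be analytic in a neighborhood of p = (x₁(t₀), x₂(t₀)) and satisfy ∂²U/∂z₁² + ∂²U/∂z₂² = −k²·U near p. Define v(t) = U(x₁(t),x₂(t)), V(t) = (∂₁U(x₁(t),x₂(t)), ∂₂U(x₁(t),x₂(t))), and f(t) = (k²q/2)·(x₂'(t) + i·x₁'(t))·v(t) + i·V₁'(t) + V₂'(t). Then f(t₀) = k²·(q−1)·U(p)·x₂'(t₀). -/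
open Complex Filter

noncomputable section

/-- Partial derivative of `U` in the first variable. -/
def P1 (U : ℂ → ℂ → ℂ) : ℂ → ℂ → ℂ := fun z w => deriv (fun z' => U z' w) z

/-- Partial derivative of `U` in the second variable. -/
def P2 (U : ℂ → ℂ → ℂ) : ℂ → ℂ → ℂ := fun z w => deriv (fun w' => U z w') w

/-- The auxiliary function `f(t) = (k²q/2)(x₂' + i x₁') v + i V₁' + V₂'`. -/
def fAux (k q : ℝ) (x1 x2 : ℂ → ℂ) (U : ℂ → ℂ → ℂ) : ℂ → ℂ := fun t =>
  ((k : ℂ) ^ 2 * (q : ℂ) / 2) * (deriv x2 t + Complex.I * deriv x1 t) * U (x1 t) (x2 t)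
    + Complex.I * deriv (fun s => P1 U (x1 s) (x2 s)) t
    + deriv (fun s => P2 U (x1 s) (x2 s)) t

/-- The first partial derivative is the total derivative applied to `(1, 0)`. -/
lemma P1_eq_of_hasFDerivAt {H : ℂ → ℂ → ℂ} {p : ℂ × ℂ} {L : ℂ × ℂ →L[ℂ] ℂ}
    (h : HasFDerivAt (fun r : ℂ × ℂ => H r.1 r.2) L p) : P1 H p.1 p.2 = L (1, 0) :=
  (h.comp_hasDerivAt (f := fun z => (z, p.2)) p.1
    ((hasDerivAt_id p.1).prodMk (hasDerivAt_const p.1 p.2))).deriv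

/-- The second partial derivative is the total derivative applied to `(0, 1)`. -/
lemma P2_eq_of_hasFDerivAt {H : ℂ → ℂ → ℂ} {p : ℂ × ℂ} {L : ℂ × ℂ →L[ℂ] ℂ}
    (h : HasFDerivAt (fun r : ℂ × ℂ => H r.1 r.2) L p) : P2 H p.1 p.2 = L (0, 1) :=
  (h.comp_hasDerivAt (f := fun w => (p.1, w)) p.2
    ((hasDerivAt_const p.2 p.1).prodMk (hasDerivAt_id p.2))).deriv

/-- Chain rule along a curve, with the total derivative split along the coordinate vectors. -/
lemma deriv_comp_curve {H : ℂ → ℂ → ℂ} {x1 x2 : ℂ → ℂ} {t : ℂ} {L : ℂ × ℂ →L[ℂ] ℂ}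
    (h : HasFDerivAt (fun r : ℂ × ℂ => H r.1 r.2) L (x1 t, x2 t))
    (h1 : DifferentiableAt ℂ x1 t) (h2 : DifferentiableAt ℂ x2 t) :
    deriv (fun s => H (x1 s) (x2 s)) t = deriv x1 t * L (1, 0) + deriv x2 t * L (0, 1) := by
  have hd := (h.comp_hasDerivAt (f := fun s => (x1 s, x2 s)) t
    (h1.hasDerivAt.prodMk h2.hasDerivAt)).deriv
  have hv : (deriv x1 t, deriv x2 t)
      = deriv x1 t • ((1, 0) : ℂ × ℂ) + deriv x2 t • ((0, 1) : ℂ × ℂ) := by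
    simp
  rw [hv, map_add, map_smul, map_smul, smul_eq_mul, smul_eq_mul] at hd
  exact hd

theorem stmt2
    (k q : ℝ) (x1 x2 : ℂ → ℂ) (t₀ : ℂ)
    (hx1 : ∀ᶠ t in nhds t₀, DifferentiableAt ℂ x1 t)
    (hx2 : ∀ᶠ t in nhds t₀, DifferentiableAt ℂ x2 t)
    (hcrit : deriv x1 t₀ + Complex.I * deriv x2 t₀ = 0)
    (U : ℂ → ℂ → ℂ)
    (hUan : AnalyticAt ℂ (fun p : ℂ × ℂ => U p.1 p.2) (x1 t₀, x2 t₀))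
    (hHelm : ∀ᶠ p in nhds ((x1 t₀, x2 t₀) : ℂ × ℂ),
      P1 (P1 U) p.1 p.2 + P2 (P2 U) p.1 p.2 = -(k : ℂ) ^ 2 * U p.1 p.2) :
    fAux k q x1 x2 U t₀ = (k : ℂ) ^ 2 * ((q : ℂ) - 1) * U (x1 t₀) (x2 t₀) * deriv x2 t₀ := by
  set F : ℂ × ℂ → ℂ := fun p => U p.1 p.2 with hF
  set p : ℂ × ℂ := (x1 t₀, x2 t₀) with hp
  set D := fderiv ℂ (fderiv ℂ F) p with hD
  have hG : HasFDerivAt (fderiv ℂ F) D p := hUan.fderiv.differentiableAt.hasFDerivAt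
  have hev : ∀ᶠ r in nhds p, HasFDerivAt F (fderiv ℂ F r) r :=
    hUan.eventually_analyticAt.mono fun r hr => hr.differentiableAt.hasFDerivAt
  have hP1 : HasFDerivAt (fun r : ℂ × ℂ => P1 U r.1 r.2)
      ((ContinuousLinearMap.apply ℂ ℂ ((1, 0) : ℂ × ℂ)).comp D) p :=
    ((ContinuousLinearMap.apply ℂ ℂ ((1, 0) : ℂ × ℂ)).hasFDerivAt.comp p hG).congr_of_eventuallyEq
      (hev.mono fun r hr => P1_eq_of_hasFDerivAt hr)
  have hP2 : HasFDerivAt (fun r : ℂ × ℂ => P2 U r.1 r.2)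
      ((ContinuousLinearMap.apply ℂ ℂ ((0, 1) : ℂ × ℂ)).comp D) p :=
    ((ContinuousLinearMap.apply ℂ ℂ ((0, 1) : ℂ × ℂ)).hasFDerivAt.comp p hG).congr_of_eventuallyEq
      (hev.mono fun r hr => P2_eq_of_hasFDerivAt hr)
  have hsymm : D (1, 0) (0, 1) = D (0, 1) (1, 0) :=
    second_derivative_symmetric_of_eventually hev hG (1, 0) (0, 1)
  have hH := hHelm.self_of_nhds
  rw [P1_eq_of_hasFDerivAt hP1, P2_eq_of_hasFDerivAt hP2] at hH
  have ha : deriv x1 t₀ = -Complex.I * deriv x2 t₀ := by linear_combination hcrit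
  unfold fAux
  rw [deriv_comp_curve hP1 hx1.self_of_nhds hx2.self_of_nhds,
    deriv_comp_curve hP2 hx1.self_of_nhds hx2.self_of_nhds, ha]
  simp only [ContinuousLinearMap.comp_apply, ContinuousLinearMap.apply_apply, hp] at hH ⊢
  linear_combination deriv x2 t₀ * hH - Complex.I * deriv x2 t₀ * hsymm +
    (-(k : ℂ) ^ 2 * q / 2 * deriv x2 t₀ * U (x1 t₀) (x2 t₀)
      - deriv x2 t₀ * D (1, 0) (1, 0)) * Complex.I_sq
end
end

section
/- Let a > b > 0, k > 0 and q > 0 with q ≠ 1, and let D = {(x₁,x₂) ∈ ℝ² : x₁²/a² + x₂²/b² < 1} be the open elliptical region. Let 𝒯₀ = { r + i s ∈ ℂ : |r| ≤ arccos√(1 − b²/a²), 0 ≤ s ≤ ln( ((1 − |sin r|)/cos r)·√((a+b)/(a−b)) ) }. Let U : ℂ² → ℂ be analytic on an open set Ω ⊆ ℂ² containing ℝ² ∪ {(a·cos t, b·sin t) : t ∈ 𝒯₀} and satisfy ∂²U/∂z₁² + ∂²U/∂z₂² + k²·U = 0 on Ω. If ∫_D U(x₁,x₂)·exp(λ·x₁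 + i·√(λ²+k²q)·x₂) dx = 0 for every λ > 0, then U( a²/√(a²−b²), i·b²/√(a²−b²) ) = 0. (Consequently, any such incident wave with U(a²/√(a²−b²), i·b²/√(a²−b²)) ≠ 0 is scattered by D.) -/
open Complex MeasureTheory Filter

noncomputable section

/-- The complexified region `𝒯₀` for the ellipse with semi-axes `a > b > 0`. -/
def ellT0 (a b : ℝ) : Set ℂ :=
  {t : ℂ | |t.re| ≤ Real.arccos (Real.sqrt (1 - b ^ 2 / a ^ 2)) ∧ 0 ≤ t.im ∧
    t.im ≤ Real.log ((1 - |Real.sin t.re|) / Real.cos t.re * Real.sqrt ((a + b) / (a - b)))}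


lemma intervalIntegral_ellipse_param {a b : ℝ} (hb : 0 < b) {P : ℝ → ℝ → ℂ}
    (hP : Continuous fun p : ℝ × ℝ => P p.1 p.2) :
    (∫ y in (-b)..b, (P (a * √(1 - y ^ 2 / b ^ 2)) y - P (-(a * √(1 - y ^ 2 / b ^ 2))) y)) =
      ∫ t in (-Real.pi)..Real.pi, P (a * Real.cos t) (b * Real.sin t) * ((b * Real.cos t : ℝ) : ℂ) := by
  set F : ℝ → ℂ := fun t => P (a * Real.cos t) (b * Real.sin t) * ((b * Real.cos t : ℝ) : ℂ) with hF
  have hFc : Continuous F := by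
    have : Continuous fun t : ℝ => P (a * Real.cos t) (b * Real.sin t) :=
      hP.comp (f := fun t : ℝ => (a * Real.cos t, b * Real.sin t)) (by fun_prop)
    fun_prop
  set g : ℝ → ℂ := fun y => P (a * √(1 - y ^ 2 / b ^ 2)) y - P (-(a * √(1 - y ^ 2 / b ^ 2))) y with hg
  have hgc : Continuous g := by
    have h1 : Continuous fun y : ℝ => P (a * √(1 - y ^ 2 / b ^ 2)) y :=
      hP.comp (f := fun y : ℝ => (a * √(1 - y ^ 2 / b ^ 2), y)) (by fun_prop)
    have h2 : Continuous fun y : ℝ => P (-(a * √(1 - y ^ 2 / b ^ 2))) y :=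
      hP.comp (f := fun y : ℝ => (-(a * √(1 - y ^ 2 / b ^ 2)), y)) (by fun_prop)
    exact h1.sub h2
  have hsub : (∫ t in (-(Real.pi / 2))..(Real.pi / 2),
      (b * Real.cos t) • (g ∘ fun t => b * Real.sin t) t) = ∫ y in (-b)..b, g y := by
    rw [intervalIntegral.integral_deriv_smul_comp (f := fun t => b * Real.sin t)
      (f' := fun t => b * Real.cos t) (g := g)
      (fun t _ => (Real.hasDerivAt_sin t).const_mul b) (by fun_prop) hgc]
    simp
  have hper : Function.Periodic F (2 * Real.pi) := fun t => by
    simp only [hF, Real.cos_add_two_pi, Real.sin_add_two_pi]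
  have hper' : (∫ t in (-Real.pi)..Real.pi, F t) =
      ∫ t in (-(Real.pi / 2))..(Real.pi / 2 + Real.pi), F t := by
    have := hper.intervalIntegral_add_eq (-Real.pi) (-(Real.pi / 2))
    convert this using 2 <;> ring
  rw [← hsub, hper', ← intervalIntegral.integral_add_adjacent_intervals
    (hFc.intervalIntegrable _ (Real.pi / 2)) (hFc.intervalIntegrable _ _)]
  have hrefl : (∫ t in (Real.pi / 2)..(Real.pi / 2 + Real.pi), F t) =
      ∫ t in (-(Real.pi / 2))..(Real.pi / 2), F (Real.pi - t) := by
    rw [intervalIntegral.integral_comp_sub_left]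
    congr 1 <;> ring
  have hFc' : Continuous fun t => F (Real.pi - t) := hFc.comp (by fun_prop)
  rw [hrefl, ← intervalIntegral.integral_add (hFc.intervalIntegrable _ _)
    (hFc'.intervalIntegrable _ _)]
  refine intervalIntegral.integral_congr fun t ht => ?_
  rw [Set.uIcc_of_le (by linarith [Real.pi_pos])] at ht
  have hc : 0 ≤ Real.cos t := Real.cos_nonneg_of_mem_Icc ht
  have hX : √(1 - (b * Real.sin t) ^ 2 / b ^ 2) = Real.cos t := by
    rw [mul_pow, mul_div_cancel_left₀ _ (by positivity), ← Real.cos_sq', Real.sqrt_sq hc]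
  simp only [hF, hg, Function.comp, hX, Real.cos_pi_sub, Real.sin_pi_sub, Complex.real_smul]
  push_cast
  rw [mul_neg a]
  ring

lemma ellipse_subset_Icc_prod_Icc {a b : ℝ} (ha : 0 < a) (hb : 0 < b) :
    {p : ℝ × ℝ | p.1 ^ 2 / a ^ 2 + p.2 ^ 2 / b ^ 2 < 1} ⊆
      Set.Icc (-a) a ×ˢ Set.Icc (-b) b := by
  rintro ⟨x, y⟩ h
  simp only [Set.mem_ofPred_eq] at h
  have h1 : 0 ≤ x ^ 2 / a ^ 2 := by positivity
  have h2 : 0 ≤ y ^ 2 / b ^ 2 := by positivity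
  have h3 : x ^ 2 / a ^ 2 < 1 := by linarith
  have h4 : y ^ 2 / b ^ 2 < 1 := by linarith
  rw [div_lt_one (by positivity)] at h3 h4
  exact ⟨abs_le.1 (abs_lt_of_sq_lt_sq h3 ha.le).le, abs_le.1 (abs_lt_of_sq_lt_sq h4 hb.le).le⟩

lemma isOpen_ellipse (a b : ℝ) :
    IsOpen {p : ℝ × ℝ | p.1 ^ 2 / a ^ 2 + p.2 ^ 2 / b ^ 2 < 1} :=
  isOpen_lt (by fun_prop) continuous_const

lemma integrableOn_ellipse {a b : ℝ} (ha : 0 < a) (hb : 0 < b) {f : ℝ × ℝ → ℂ}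
    (hf : Continuous f) :
    IntegrableOn f {p : ℝ × ℝ | p.1 ^ 2 / a ^ 2 + p.2 ^ 2 / b ^ 2 < 1} :=
  (hf.continuousOn.integrableOn_compact (isCompact_Icc.prod isCompact_Icc)).mono_set
    (ellipse_subset_Icc_prod_Icc ha hb)

/-- Green's theorem on an ellipse for the first partial derivative. -/
lemma setIntegral_ellipse_deriv_fst {a b : ℝ} (ha : 0 < a) (hb : 0 < b) {P P' : ℝ → ℝ → ℂ}
    (hP : Continuous fun p : ℝ × ℝ => P p.1 p.2) (hP' : Continuous fun p : ℝ × ℝ => P' p.1 p.2)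
    (hd : ∀ x y, HasDerivAt (fun x => P x y) (P' x y) x) :
    (∫ p in {p : ℝ × ℝ | p.1 ^ 2 / a ^ 2 + p.2 ^ 2 / b ^ 2 < 1}, P' p.1 p.2) =
      ∫ t in (-Real.pi)..Real.pi,
        P (a * Real.cos t) (b * Real.sin t) * ((b * Real.cos t : ℝ) : ℂ) := by
  rw [← intervalIntegral_ellipse_param hb hP]
  set D := {p : ℝ × ℝ | p.1 ^ 2 / a ^ 2 + p.2 ^ 2 / b ^ 2 < 1} with hD
  have hDm : MeasurableSet D := (isOpen_ellipse a b).measurableSet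
  have hint := (integrableOn_ellipse ha hb hP').integrable_indicator hDm
  rw [← integral_indicator hDm, Measure.volume_eq_prod, integral_prod_symm _ hint]
  have hsec : ∀ y : ℝ, (∫ x, D.indicator (fun p : ℝ × ℝ => P' p.1 p.2) (x, y)) =
      P (a * √(1 - y ^ 2 / b ^ 2)) y - P (-(a * √(1 - y ^ 2 / b ^ 2))) y := by
    intro y
    set X := a * √(1 - y ^ 2 / b ^ 2) with hX
    have hX0 : 0 ≤ X := by positivity
    have hmem : ∀ x : ℝ, (x, y) ∈ D ↔ x ∈ Set.Ioo (-X) X := by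
      intro x
      rw [Set.mem_Ioo, ← abs_lt, hX, ← div_lt_iff₀' ha, Real.lt_sqrt (by positivity), div_pow,
        sq_abs, hD, Set.mem_ofPred_eq, lt_sub_iff_add_lt]
    have h1 : (fun x => D.indicator (fun p : ℝ × ℝ => P' p.1 p.2) (x, y)) =
        (Set.Ioo (-X) X).indicator fun x => P' x y := by
      ext x
      by_cases hx : x ∈ Set.Ioo (-X) X
      · rw [Set.indicator_of_mem hx, Set.indicator_of_mem ((hmem x).2 hx)]
      · rw [Set.indicator_of_notMem hx, Set.indicator_of_notMem (fun h => hx ((hmem x).1 h))]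
    rw [h1, integral_indicator measurableSet_Ioo, ← integral_Ioc_eq_integral_Ioo,
      ← intervalIntegral.integral_of_le (by linarith)]
    refine intervalIntegral.integral_eq_sub_of_hasDerivAt (fun x _ => hd x y) ?_
    exact (hP'.comp (f := fun x : ℝ => (x, y)) (by fun_prop)).intervalIntegrable _ _
  rw [integral_congr_ae (.of_forall hsec), intervalIntegral.integral_of_le (by linarith)]
  refine (setIntegral_eq_integral_of_forall_compl_eq_zero fun y hy => ?_).symm
  have : 1 - y ^ 2 / b ^ 2 ≤ 0 := by
    rw [sub_nonpos, one_le_div (by positivity), sq_le_sq, abs_of_pos hb]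
    by_contra! h
    exact hy ⟨(abs_lt.1 h).1, (abs_lt.1 h).2.le⟩
  simp [Real.sqrt_eq_zero_of_nonpos this]

/-- Green's theorem on an ellipse for the second partial derivative. -/
lemma setIntegral_ellipse_deriv_snd {a b : ℝ} (ha : 0 < a) (hb : 0 < b) {Q Q' : ℝ → ℝ → ℂ}
    (hQ : Continuous fun p : ℝ × ℝ => Q p.1 p.2) (hQ' : Continuous fun p : ℝ × ℝ => Q' p.1 p.2)
    (hd : ∀ x y, HasDerivAt (fun y => Q x y) (Q' x y) y) :
    (∫ p in {p : ℝ × ℝ | p.1 ^ 2 / a ^ 2 + p.2 ^ 2 / b ^ 2 < 1}, Q' p.1 p.2) =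
      ∫ t in (-Real.pi)..Real.pi,
        Q (a * Real.cos t) (b * Real.sin t) * ((a * Real.sin t : ℝ) : ℂ) := by
  have h := setIntegral_ellipse_deriv_fst hb ha (P := fun x y => Q y x) (P' := fun x y => Q' y x)
    (hQ.comp continuous_swap) (hQ'.comp continuous_swap) (fun x y => hd y x)
  have hswap := (Measure.measurePreserving_swap (μ := (volume : Measure ℝ))
    (ν := (volume : Measure ℝ))).setIntegral_preimage_emb
      MeasurableEquiv.prodComm.measurableEmbedding (fun p : ℝ × ℝ => Q' p.1 p.2)
      {p : ℝ × ℝ | p.1 ^ 2 / a ^ 2 + p.2 ^ 2 / b ^ 2 < 1}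
  rw [Measure.volume_eq_prod, ← hswap]
  simp only [Set.preimage_ofPred_eq, Prod.fst_swap, Prod.snd_swap]
  simp only [add_comm (_ / b ^ 2)] at h
  rw [Measure.volume_eq_prod] at h
  simp only [add_comm (_ / a ^ 2)] at h ⊢
  rw [h]
  set F : ℝ → ℂ := fun t => Q (a * Real.cos t) (b * Real.sin t) * ((a * Real.sin t : ℝ) : ℂ) with hF
  have hper : Function.Periodic F (2 * Real.pi) := fun t => by
    simp only [hF, Real.cos_add_two_pi, Real.sin_add_two_pi]
  have h2 : (fun t : ℝ => Q (a * Real.sin t) (b * Real.cos t) * ((a * Real.cos t : ℝ) : ℂ)) =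
    fun t => F (Real.pi / 2 - t) := by
      ext t; simp only [hF, Real.cos_pi_div_two_sub, Real.sin_pi_div_two_sub]
  rw [h2, intervalIntegral.integral_comp_sub_left]
  have := hper.intervalIntegral_add_eq (-Real.pi) (Real.pi / 2 - Real.pi)
  convert this.symm using 2 <;> ring

lemma hasFDerivAt_partials {V : ℂ → ℂ → ℂ} {p : ℂ × ℂ}
    (hV : AnalyticAt ℂ (fun p : ℂ × ℂ => V p.1 p.2) p) :
    P1 V p.1 p.2 = fderiv ℂ (fun p : ℂ × ℂ => V p.1 p.2) p (1, 0) ∧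
      P2 V p.1 p.2 = fderiv ℂ (fun p : ℂ × ℂ => V p.1 p.2) p (0, 1) := by
  have h := hV.differentiableAt.hasFDerivAt
  constructor
  · exact (h.comp_hasDerivAt (f := fun z => (z, p.2)) p.1
      ((hasDerivAt_id p.1).prodMk (hasDerivAt_const p.1 p.2))).deriv
  · exact (h.comp_hasDerivAt (f := fun z => (p.1, z)) p.2
      ((hasDerivAt_const p.2 p.1).prodMk (hasDerivAt_id p.2))).deriv

lemma AnalyticAt.comp_partials {V : ℂ → ℂ → ℂ} {x y : ℂ → ℂ} {x' y' t : ℂ}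
    (hV : AnalyticAt ℂ (fun p : ℂ × ℂ => V p.1 p.2) (x t, y t))
    (hx : HasDerivAt x x' t) (hy : HasDerivAt y y' t) :
    HasDerivAt (fun t => V (x t) (y t)) (P1 V (x t) (y t) * x' + P2 V (x t) (y t) * y') t := by
  have h := hV.differentiableAt.hasFDerivAt.comp_hasDerivAt (f := fun t => (x t, y t)) t
    (hx.prodMk hy)
  refine h.congr_deriv ?_
  have e : (x', y') = x' • ((1 : ℂ), (0 : ℂ)) + y' • ((0 : ℂ), (1 : ℂ)) := by simp
  obtain ⟨h1, h2⟩ := hasFDerivAt_partials hV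
  simp only at h1 h2
  rw [e, map_add, map_smul, map_smul, h1, h2, smul_eq_mul, smul_eq_mul, mul_comm, mul_comm y']

lemma AnalyticAt.partial_fst {V : ℂ → ℂ → ℂ} {p : ℂ × ℂ}
    (hV : AnalyticAt ℂ (fun p : ℂ × ℂ => V p.1 p.2) p) :
    AnalyticAt ℂ (fun p : ℂ × ℂ => P1 V p.1 p.2) p :=
  ((ContinuousLinearMap.apply ℂ ℂ ((1 : ℂ), (0 : ℂ))).analyticAt _).comp hV.fderiv |>.congr <| by
    filter_upwards [hV.eventually_analyticAt] with z hz using (hasFDerivAt_partials hz).1.symm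

lemma AnalyticAt.partial_snd {V : ℂ → ℂ → ℂ} {p : ℂ × ℂ}
    (hV : AnalyticAt ℂ (fun p : ℂ × ℂ => V p.1 p.2) p) :
    AnalyticAt ℂ (fun p : ℂ × ℂ => P2 V p.1 p.2) p :=
  ((ContinuousLinearMap.apply ℂ ℂ ((0 : ℂ), (1 : ℂ))).analyticAt _).comp hV.fderiv |>.congr <| by
    filter_upwards [hV.eventually_analyticAt] with z hz using (hasFDerivAt_partials hz).2.symm

lemma partials_comm {V : ℂ → ℂ → ℂ} {p : ℂ × ℂ}
    (hV : AnalyticAt ℂ (fun p : ℂ × ℂ => V p.1 p.2) p) :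
    P1 (P2 V) p.1 p.2 = P2 (P1 V) p.1 p.2 := by
  have hs : IsSymmSndFDerivAt ℂ (fun p : ℂ × ℂ => V p.1 p.2) p :=
    (hV.contDiffAt (n := ⊤)).isSymmSndFDerivAt (by simp)
  have hd : DifferentiableAt ℂ (fderiv ℂ (fun p : ℂ × ℂ => V p.1 p.2)) p :=
    hV.fderiv.differentiableAt
  have key : ∀ v w : ℂ × ℂ, fderiv ℂ (fun z => fderiv ℂ (fun p : ℂ × ℂ => V p.1 p.2) z v) p w =
      fderiv ℂ (fderiv ℂ (fun p : ℂ × ℂ => V p.1 p.2)) p w v := by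
    intro v w
    rw [fderiv_clm_apply hd (differentiableAt_const v)]
    simp
  have e1 : (fun p : ℂ × ℂ => P1 V p.1 p.2) =ᶠ[nhds p]
      fun z => fderiv ℂ (fun p : ℂ × ℂ => V p.1 p.2) z (1, 0) := by
    filter_upwards [hV.eventually_analyticAt] with z hz using (hasFDerivAt_partials hz).1
  have e2 : (fun p : ℂ × ℂ => P2 V p.1 p.2) =ᶠ[nhds p]
      fun z => fderiv ℂ (fun p : ℂ × ℂ => V p.1 p.2) z (0, 1) := by
    filter_upwards [hV.eventually_analyticAt] with z hz using (hasFDerivAt_partials hz).2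
  rw [(hasFDerivAt_partials hV.partial_snd).1, (hasFDerivAt_partials hV.partial_fst).2,
    e1.fderiv_eq, e2.fderiv_eq, key, key]
  exact hs.eq _ _

/-- The amplitude of the boundary integral over the ellipse, after two integrations by parts. -/
def ellAmp (U : ℂ → ℂ → ℂ) (a b e m : ℝ) (t : ℂ) : ℂ :=
  I * ((P1 (P1 U) (a * cos t) (b * sin t) - I * P1 (P2 U) (a * cos t) (b * sin t)) *
        (-(a * sin t)) +
      (P2 (P1 U) (a * cos t) (b * sin t) - I * P2 (P2 U) (a * cos t) (b * sin t)) *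
        (b * cos t)) -
    e * (b * cos t) * (P1 U (a * cos t) (b * sin t) - I * P2 U (a * cos t) (b * sin t)) +
    m * U (a * cos t) (b * sin t) * (b * cos t - I * (a * sin t))

/-- If the Helmholtz solution `U` is orthogonal on the ellipse to the exponential, then so is
the amplitude `ellAmp` on the boundary. -/
lemma integral_ellAmp_eq_zero {a b k q lam mu : ℝ} (ha : 0 < a) (hb : 0 < b) (hlam : 0 < lam)
    (hmu : mu ^ 2 = lam ^ 2 + k ^ 2 * q) {U : ℂ → ℂ → ℂ} {Ω : Set (ℂ × ℂ)}
    (hΩR : ∀ p : ℝ × ℝ, ((p.1 : ℂ), (p.2 : ℂ)) ∈ Ω)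
    (hUan : ∀ p ∈ Ω, AnalyticAt ℂ (fun p : ℂ × ℂ => U p.1 p.2) p)
    (hHelm : ∀ p ∈ Ω, P1 (P1 U) p.1 p.2 + P2 (P2 U) p.1 p.2 + (k : ℂ) ^ 2 * U p.1 p.2 = 0)
    (h0 : (∫ p in {p : ℝ × ℝ | p.1 ^ 2 / a ^ 2 + p.2 ^ 2 / b ^ 2 < 1},
      U (p.1 : ℂ) (p.2 : ℂ) * cexp ((lam : ℂ) * (p.1 : ℂ) + I * (mu : ℂ) * (p.2 : ℂ))) = 0) :
    (∫ t in (-Real.pi)..Real.pi, cexp (lam * (a * cos (t : ℂ)) + I * mu * (b * sin (t : ℂ))) *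
      ellAmp U a b (mu - lam) (lam * (mu - lam)) t) = 0 := by
  have hcont : ∀ {V : ℂ → ℂ → ℂ}, (∀ p ∈ Ω, AnalyticAt ℂ (fun p : ℂ × ℂ => V p.1 p.2) p) →
      Continuous fun p : ℝ × ℝ => V p.1 p.2 := by
    intro V hV
    refine continuous_iff_continuousAt.2 fun p => ?_
    exact ContinuousAt.comp (f := fun p : ℝ × ℝ => ((p.1 : ℂ), (p.2 : ℂ)))
      (hV _ (hΩR p)).continuousAt (by fun_prop)
  have hU1 : ∀ p ∈ Ω, AnalyticAt ℂ (fun p : ℂ × ℂ => P1 U p.1 p.2) p :=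
    fun p hp => (hUan p hp).partial_fst
  have hU2 : ∀ p ∈ Ω, AnalyticAt ℂ (fun p : ℂ × ℂ => P2 U p.1 p.2) p :=
    fun p hp => (hUan p hp).partial_snd
  have hU11 : ∀ p ∈ Ω, AnalyticAt ℂ (fun p : ℂ × ℂ => P1 (P1 U) p.1 p.2) p :=
    fun p hp => (hU1 p hp).partial_fst
  have hU22 : ∀ p ∈ Ω, AnalyticAt ℂ (fun p : ℂ × ℂ => P2 (P2 U) p.1 p.2) p :=
    fun p hp => (hU2 p hp).partial_snd
  have hU12 : ∀ p ∈ Ω, AnalyticAt ℂ (fun p : ℂ × ℂ => P2 (P1 U) p.1 p.2) p :=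
    fun p hp => (hU1 p hp).partial_snd
  have hU21 : ∀ p ∈ Ω, AnalyticAt ℂ (fun p : ℂ × ℂ => P1 (P2 U) p.1 p.2) p :=
    fun p hp => (hU2 p hp).partial_fst
  have cU := hcont hUan
  have cU1 := hcont hU1
  have cU2 := hcont hU2
  have cU11 := hcont hU11
  have cU22 := hcont hU22
  have cU12 := hcont hU12
  have cU21 := hcont hU21
  have hfst : ∀ {V : ℂ → ℂ → ℂ}, (∀ p ∈ Ω, AnalyticAt ℂ (fun p : ℂ × ℂ => V p.1 p.2) p) →
      ∀ x y : ℝ, HasDerivAt (fun z : ℂ => V z y) (P1 V x y) (x : ℂ) := by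
    intro V hV x y
    simpa using (hV _ (hΩR (x, y))).comp_partials (x := fun z => z) (y := fun _ => (y : ℂ))
      (hasDerivAt_id _) (hasDerivAt_const _ _)
  have hsnd : ∀ {V : ℂ → ℂ → ℂ}, (∀ p ∈ Ω, AnalyticAt ℂ (fun p : ℂ × ℂ => V p.1 p.2) p) →
      ∀ x y : ℝ, HasDerivAt (fun z : ℂ => V x z) (P2 V x y) (y : ℂ) := by
    intro V hV x y
    simpa using (hV _ (hΩR (x, y))).comp_partials (x := fun _ => (x : ℂ)) (y := fun z => z)
      (hasDerivAt_const _ _) (hasDerivAt_id _)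
  have cw : Continuous fun p : ℝ × ℝ => cexp (lam * p.1 + I * mu * p.2) := by fun_prop
  have cP' : Continuous fun p : ℝ × ℝ =>
      cexp (lam * p.1 + I * mu * p.2) * (P1 (P1 U) p.1 p.2 - lam ^ 2 * U p.1 p.2) :=
    cw.mul (cU11.sub (continuous_const.mul cU))
  have cQ' : Continuous fun p : ℝ × ℝ =>
      cexp (lam * p.1 + I * mu * p.2) * (P2 (P2 U) p.1 p.2 + mu ^ 2 * U p.1 p.2) :=
    cw.mul (cU22.add (continuous_const.mul cU))
  have green1 := setIntegral_ellipse_deriv_fst ha hb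
    (P := fun x y => cexp (lam * x + I * mu * y) * (P1 U x y - lam * U x y))
    (P' := fun x y => cexp (lam * x + I * mu * y) * (P1 (P1 U) x y - lam ^ 2 * U x y))
    (cw.mul (cU1.sub (continuous_const.mul cU))) cP' (by
      intro x y
      have hw : HasDerivAt (fun z : ℂ => cexp (lam * z + I * mu * y))
          (cexp (lam * x + I * mu * y) * (lam * 1)) (x : ℂ) :=
        (((hasDerivAt_id _).const_mul _).add_const _).cexp
      refine ((hw.mul ((hfst hU1 x y).fun_sub ((hfst hUan x y).const_mul _))).comp_ofReal).congr_deriv ?_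
      ring)
  have green2 := setIntegral_ellipse_deriv_snd ha hb
    (Q := fun x y => cexp (lam * x + I * mu * y) * (P2 U x y - I * mu * U x y))
    (Q' := fun x y => cexp (lam * x + I * mu * y) * (P2 (P2 U) x y + mu ^ 2 * U x y))
    (cw.mul (cU2.sub (continuous_const.mul cU))) cQ' (by
      intro x y
      have hw : HasDerivAt (fun z : ℂ => cexp (lam * x + I * mu * z))
          (cexp (lam * x + I * mu * y) * (I * mu * 1)) (y : ℂ) :=
        (((hasDerivAt_id _).const_mul _).const_add _).cexp
      refine ((hw.mul ((hsnd hU2 x y).fun_sub ((hsnd hUan x y).const_mul _))).comp_ofReal).congr_deriv ?_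
      linear_combination (-cexp (lam * x + I * mu * y) * mu ^ 2 * U x y) * I_sq)
  have hmu' : (mu : ℂ) ^ 2 = lam ^ 2 + k ^ 2 * q := by exact_mod_cast hmu
  have hsum : (∫ p in {p : ℝ × ℝ | p.1 ^ 2 / a ^ 2 + p.2 ^ 2 / b ^ 2 < 1},
        cexp (lam * p.1 + I * mu * p.2) * (P1 (P1 U) p.1 p.2 - lam ^ 2 * U p.1 p.2)) +
      (∫ p in {p : ℝ × ℝ | p.1 ^ 2 / a ^ 2 + p.2 ^ 2 / b ^ 2 < 1},
        cexp (lam * p.1 + I * mu * p.2) * (P2 (P2 U) p.1 p.2 + mu ^ 2 * U p.1 p.2)) = 0 := by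
    rw [← integral_add (integrableOn_ellipse ha hb cP')
      (integrableOn_ellipse ha hb cQ')]
    rw [← mul_zero ((k : ℂ) ^ 2 * (q - 1)), ← h0, ← integral_const_mul]
    refine integral_congr_ae (.of_forall fun p => ?_)
    have := hHelm _ (hΩR p)
    simp only at this ⊢
    linear_combination cexp (lam * p.1 + I * mu * p.2) * this +
      cexp (lam * p.1 + I * mu * p.2) * U p.1 p.2 * hmu'
  rw [green1, green2] at hsum
  have cell : ∀ {V : ℂ → ℂ → ℂ}, (Continuous fun p : ℝ × ℝ => V p.1 p.2) →
      Continuous fun t : ℝ => V (a * cos (t : ℂ)) (b * sin (t : ℂ)) := by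
    intro V hV
    have := hV.comp (f := fun t : ℝ => (a * Real.cos t, b * Real.sin t)) (by fun_prop)
    simpa [Function.comp_def] using this
  have dU := cell cU
  have dU1 := cell cU1
  have dU2 := cell cU2
  have dU11 := cell cU11
  have dU12 := cell cU12
  have dU21 := cell cU21
  have dU22 := cell cU22
  have hcurve : ∀ {V : ℂ → ℂ → ℂ}, (∀ p ∈ Ω, AnalyticAt ℂ (fun p : ℂ × ℂ => V p.1 p.2) p) →
      ∀ t : ℝ, HasDerivAt (fun z : ℂ => V (a * cos z) (b * sin z))
        (P1 V (a * cos t) (b * sin t) * (a * (-sin t)) +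
          P2 V (a * cos t) (b * sin t) * (b * cos t)) (t : ℂ) := by
    intro V hV t
    refine AnalyticAt.comp_partials (x := fun z => a * cos z) (y := fun z => b * sin z) ?_
      ((hasDerivAt_cos _).const_mul _) ((hasDerivAt_sin _).const_mul _)
    have := hV _ (hΩR (a * Real.cos t, b * Real.sin t))
    simpa using this
  set S : ℂ → ℂ := fun z => cexp (lam * (a * cos z) + I * mu * (b * sin z)) *
    (-I * U (a * cos z) (b * sin z) + I / lam *
      (P1 U (a * cos z) (b * sin z) - I * P2 U (a * cos z) (b * sin z))) with hS
  set S' : ℝ → ℂ := fun t =>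
    cexp (lam * (a * cos t) + I * mu * (b * sin t)) *
        (lam * (a * (-sin t)) + I * mu * (b * cos t)) *
      (-I * U (a * cos t) (b * sin t) + I / lam *
        (P1 U (a * cos t) (b * sin t) - I * P2 U (a * cos t) (b * sin t))) +
    cexp (lam * (a * cos t) + I * mu * (b * sin t)) *
      (-I * (P1 U (a * cos t) (b * sin t) * (a * (-sin t)) +
          P2 U (a * cos t) (b * sin t) * (b * cos t)) + I / lam *
        ((P1 (P1 U) (a * cos t) (b * sin t) * (a * (-sin t)) +
          P2 (P1 U) (a * cos t) (b * sin t) * (b * cos t)) -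
        I * (P1 (P2 U) (a * cos t) (b * sin t) * (a * (-sin t)) +
          P2 (P2 U) (a * cos t) (b * sin t) * (b * cos t)))) with hS'
  have hSd : ∀ t : ℝ, HasDerivAt (fun t : ℝ => S t) (S' t) t := by
    intro t
    have hw : HasDerivAt (fun z : ℂ => cexp (lam * (a * cos z) + I * mu * (b * sin z))) _ (t : ℂ) :=
      ((((hasDerivAt_cos _).const_mul (a : ℂ)).const_mul (lam : ℂ)).add
        (((hasDerivAt_sin _).const_mul (b : ℂ)).const_mul (I * mu : ℂ))).cexp
    exact (hw.mul (((hcurve hUan t).const_mul (-I)).add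
      (((hcurve hU1 t).sub ((hcurve hU2 t).const_mul I)).const_mul (I / lam)))).comp_ofReal
  have E : Continuous fun t : ℝ => cexp (lam * (a * cos (t : ℂ)) + I * mu * (b * sin (t : ℂ))) := by
    fun_prop
  have cs : Continuous fun t : ℝ => (a : ℂ) * (-sin (t : ℂ)) := by fun_prop
  have cc : Continuous fun t : ℝ => (b : ℂ) * cos (t : ℂ) := by fun_prop
  have cs' : Continuous fun t : ℝ => (a : ℂ) * sin (t : ℂ) := by fun_prop
  have hS'c : Continuous S' :=
    ((E.mul ((continuous_const.mul cs).add (continuous_const.mul cc))).mul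
      ((continuous_const.mul dU).add (continuous_const.mul (dU1.sub (continuous_const.mul dU2))))).add
    (E.mul ((continuous_const.mul ((dU1.mul cs).add (dU2.mul cc))).add
      (continuous_const.mul (((dU11.mul cs).add (dU12.mul cc)).sub
        (continuous_const.mul ((dU21.mul cs).add (dU22.mul cc)))))))
  have cA1 : Continuous fun t : ℝ => cexp (lam * (a * cos (t : ℂ)) + I * mu * (b * sin (t : ℂ))) *
      (P1 U (a * cos (t : ℂ)) (b * sin (t : ℂ)) - lam * U (a * cos (t : ℂ)) (b * sin (t : ℂ))) *
      (b * cos (t : ℂ)) :=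
    (E.mul (dU1.sub (continuous_const.mul dU))).mul cc
  have cA2 : Continuous fun t : ℝ => cexp (lam * (a * cos (t : ℂ)) + I * mu * (b * sin (t : ℂ))) *
      (P2 U (a * cos (t : ℂ)) (b * sin (t : ℂ)) - I * mu * U (a * cos (t : ℂ)) (b * sin (t : ℂ))) *
      (a * sin (t : ℂ)) :=
    (E.mul (dU2.sub (continuous_const.mul dU))).mul cs'
  have hS0 : (∫ t in (-Real.pi)..Real.pi, S' t) = 0 := by
    rw [intervalIntegral.integral_eq_sub_of_hasDerivAt (fun t _ => hSd t)
      (hS'c.intervalIntegrable _ _)]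
    simp [hS]
  push_cast at hsum
  have htot : (∫ t in (-Real.pi)..Real.pi,
      (cexp (lam * (a * cos (t : ℂ)) + I * mu * (b * sin (t : ℂ))) *
        (P1 U (a * cos (t : ℂ)) (b * sin (t : ℂ)) - lam * U (a * cos (t : ℂ)) (b * sin (t : ℂ))) *
        (b * cos (t : ℂ)) +
      cexp (lam * (a * cos (t : ℂ)) + I * mu * (b * sin (t : ℂ))) *
        (P2 U (a * cos (t : ℂ)) (b * sin (t : ℂ)) - I * mu * U (a * cos (t : ℂ)) (b * sin (t : ℂ))) *
        (a * sin (t : ℂ)) + S' t)) = 0 := by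
    rw [intervalIntegral.integral_add ((cA1.fun_add cA2).intervalIntegrable _ _)
      (hS'c.intervalIntegrable _ _), hS0, add_zero,
      intervalIntegral.integral_add (cA1.intervalIntegrable _ _) (cA2.intervalIntegrable _ _), hsum]
  rw [← mul_zero (lam : ℂ), ← htot, ← intervalIntegral.integral_const_mul]
  refine intervalIntegral.integral_congr fun t _ => ?_
  have hJ : (lam : ℂ) * (I / lam) = I := mul_div_cancel₀ _ (by exact_mod_cast hlam.ne')
  simp only [hS', ellAmp]
  push_cast
  generalize (I / lam : ℂ) = J at hJ
  generalize cexp (lam * (a * cos t) + I * mu * (b * sin t)) = e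
  generalize P1 (P1 U) (a * cos t) (b * sin t) = u11
  generalize P1 (P2 U) (a * cos t) (b * sin t) = u21
  generalize P2 (P1 U) (a * cos t) (b * sin t) = u12
  generalize P2 (P2 U) (a * cos t) (b * sin t) = u22
  generalize P1 U (a * cos t) (b * sin t) = u1
  generalize P2 U (a * cos t) (b * sin t) = u2
  generalize U (a * cos t) (b * sin t) = u
  linear_combination -e * ((lam * (a * (-sin t)) + I * mu * (b * cos t)) * (u1 - I * u2) +
    ((u11 * (a * (-sin t)) + u12 * (b * cos t)) - I * (u21 * (a * (-sin t)) + u22 * (b * cos t)))) * hJ -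
    e * (-lam * mu * u * (b * cos t) + mu * (b * cos t) * u1 + lam * (a * sin t) * u2
      - I * mu * (b * cos t) * u2) * I_sq

lemma tendsto_mul_exp_neg_sq {η : ℝ} (hη : 0 < η) :
    Tendsto (fun n : ℝ => n * Real.exp (-(n ^ 2 * η))) atTop (nhds 0) := by
  have hlim : Tendsto (fun n : ℝ => η⁻¹ * n⁻¹) atTop (nhds 0) := by
    simpa using tendsto_inv_atTop_zero.const_mul η⁻¹
  refine squeeze_zero' ?_ ?_ hlim
  · filter_upwards [eventually_ge_atTop 0] with n hn using by positivity
  · filter_upwards [eventually_gt_atTop 0] with n hn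
    have h1 : n ^ 2 * η ≤ Real.exp (n ^ 2 * η) := by linarith [Real.add_one_le_exp (n ^ 2 * η)]
    rw [Real.exp_neg]
    calc n * (Real.exp (n ^ 2 * η))⁻¹ ≤ n * (n ^ 2 * η)⁻¹ := by gcongr
      _ = η⁻¹ * n⁻¹ := by field_simp

/-- An exponential weight that is small along a curve makes the integrals along it negligible. -/
lemma tendsto_mul_integral_curve {N : Set ℂ} {f : ℝ → ℂ → ℂ} {ρ : ℂ → ℝ} (hρ : Continuous ρ)
    (hbd : ∀ K ⊆ N, IsCompact K → ∃ C : ℝ, ∀ᶠ n : ℝ in atTop, ∀ z ∈ K,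
      ‖f n z‖ ≤ C * Real.exp (n ^ 2 * ρ z))
    {γ : ℝ → ℂ} (hγ : Continuous γ) {α β : ℝ}
    (hN : ∀ x ∈ Set.uIcc α β, γ x ∈ N ∧ ρ (γ x) < 0) :
    Tendsto (fun n : ℝ => (n : ℂ) * ∫ x in α..β, f n (γ x)) atTop (nhds 0) := by
  have hK : IsCompact (γ '' Set.uIcc α β) := isCompact_uIcc.image hγ
  obtain ⟨C, hC⟩ := hbd _ (by rintro _ ⟨x, hx, rfl⟩; exact (hN x hx).1) hK
  obtain ⟨z₀, ⟨x₀, hx₀, rfl⟩, hmax⟩ := hK.exists_isMaxOn (Set.nonempty_uIcc.image γ) hρ.continuousOn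
  set η := -ρ (γ x₀) with hη
  have hη0 : 0 < η := by linarith [(hN x₀ hx₀).2]
  have hlim : Tendsto (fun n : ℝ => n * Real.exp (-(n ^ 2 * η)) * (|C| * |β - α|)) atTop (nhds 0) := by
    simpa using (tendsto_mul_exp_neg_sq hη0).mul_const (|C| * |β - α|)
  refine squeeze_zero_norm' ?_ hlim
  filter_upwards [hC, eventually_ge_atTop 0] with n hn hn0
  have hint : ‖∫ x in α..β, f n (γ x)‖ ≤ |C| * Real.exp (-(n ^ 2 * η)) * |β - α| := by
    refine intervalIntegral.norm_integral_le_of_norm_le_const fun x hx => ?_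
    have hx' := Set.uIoc_subset_uIcc hx
    have hle : ρ (γ x) ≤ -η := by
      have := hmax (Set.mem_image_of_mem γ hx')
      simp only [hη, neg_neg]
      exact this
    refine (hn _ (Set.mem_image_of_mem γ hx')).trans ?_
    refine mul_le_mul (le_abs_self C) (Real.exp_le_exp.2 ?_) (Real.exp_pos _).le (abs_nonneg C)
    nlinarith [sq_nonneg n]
  rw [norm_mul, Complex.norm_real, Real.norm_of_nonneg hn0]
  calc n * ‖∫ x in α..β, f n (γ x)‖ ≤ n * (|C| * Real.exp (-(n ^ 2 * η)) * |β - α|) := by gcongr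
    _ = _ := by ring

/-- The contour from `r` up to height `H r`, along the graph of `H`, and down at `r'` may replace
the segment from `r` to `r'`; the graph contributes negligibly. -/
lemma tendsto_mul_contour {N : Set ℂ} (hNo : IsOpen N) (hreal : ∀ x : ℝ, (x : ℂ) ∈ N)
    {f : ℝ → ℂ → ℂ} (hd : ∀ n, DifferentiableOn ℂ (f n) N) {ρ : ℂ → ℝ} (hρ : Continuous ρ)
    (hbd : ∀ K ⊆ N, IsCompact K → ∃ C : ℝ, ∀ᶠ n : ℝ in atTop, ∀ z ∈ K,
      ‖f n z‖ ≤ C * Real.exp (n ^ 2 * ρ z))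
    {H : ℝ → ℝ} (hH : Continuous H) {S : Set ℝ} (hS : IsPreconnected S)
    (hHN : ∀ r ∈ S, ∀ y ∈ Set.uIcc 0 (H r), (r + y * I : ℂ) ∈ N)
    (hneg : ∀ r ∈ S, ρ (r + H r * I) < 0) {r r' : ℝ} (hr : r ∈ S) (hr' : r' ∈ S) :
    Tendsto (fun n : ℝ => (n : ℂ) * ((∫ x in r..r', f n x) +
      I * (∫ y in (0 : ℝ)..H r', f n (r' + y * I)) - I * ∫ y in (0 : ℝ)..H r, f n (r + y * I)))
      atTop (nhds 0) := by
  have hfi : ∀ (n : ℝ) {γ : ℝ → ℂ}, Continuous γ → ∀ {α β : ℝ}, (∀ x ∈ Set.uIcc α β, γ x ∈ N) →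
      IntervalIntegrable (fun x => f n (γ x)) volume α β := fun n γ hγ α β h =>
    ((hd n).continuousOn.comp hγ.continuousOn h).intervalIntegrable
  refine hS.induction₂ (fun r r' : ℝ => Tendsto (fun n : ℝ => (n : ℂ) * ((∫ x in r..r', f n x) +
      I * (∫ y in (0 : ℝ)..H r', f n (r' + y * I)) - I * ∫ y in (0 : ℝ)..H r, f n (r + y * I)))
      atTop (nhds 0)) ?_ ?_ ?_ hr hr'
  · intro r hr
    have h1 : ∀ᶠ x : ℝ in nhds r, ∀ y ∈ Set.uIcc 0 (H r), (x + y * I : ℂ) ∈ N := by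
      refine isCompact_uIcc.eventually_forall_of_forall_eventually fun y hy => ?_
      exact (hNo.preimage (by fun_prop : Continuous fun p : ℝ × ℝ => (p.1 + p.2 * I : ℂ))).mem_nhds
        (x := (r, y)) (hHN r hr y hy)
    have h2 : ∀ᶠ p : ℝ × ℝ in nhds (r, H r), (p.1 + p.2 * I : ℂ) ∈ N ∧ ρ (p.1 + p.2 * I) < 0 :=
      ((hNo.inter (isOpen_lt hρ continuous_const)).preimage
        (by fun_prop : Continuous fun p : ℝ × ℝ => (p.1 + p.2 * I : ℂ))).mem_nhds
        (x := (r, H r)) ⟨hHN r hr _ Set.right_mem_uIcc, hneg r hr⟩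
    obtain ⟨δ₁, hδ₁, h1⟩ := Metric.eventually_nhds_iff_ball.1 h1
    obtain ⟨δ₂, hδ₂, h2⟩ := Metric.eventually_nhds_iff_ball.1 h2
    have hball : ∀ x y : ℝ, x ∈ Metric.ball r δ₂ → y ∈ Metric.ball (H r) δ₂ →
        (x + y * I : ℂ) ∈ N ∧ ρ (x + y * I) < 0 := fun x y hx hy =>
      h2 (x, y) (by rw [← ball_prod_same]; exact ⟨hx, hy⟩)
    refine mem_nhdsWithin_of_mem_nhds ?_
    filter_upwards [Metric.ball_mem_nhds r hδ₁, Metric.ball_mem_nhds r hδ₂,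
      hH.continuousAt.preimage_mem_nhds (Metric.ball_mem_nhds (H r) hδ₂)] with r' hr1 hr2 hr3
    have hsub1 : Set.uIcc r r' ⊆ Metric.ball r δ₁ := by
      have := (convex_ball r δ₁).ordConnected
      exact this.uIcc_subset (Metric.mem_ball_self hδ₁) hr1
    have hsub2 : Set.uIcc r r' ⊆ Metric.ball r δ₂ := by
      have := (convex_ball r δ₂).ordConnected
      exact this.uIcc_subset (Metric.mem_ball_self hδ₂) hr2
    have hsub3 : Set.uIcc (H r) (H r') ⊆ Metric.ball (H r) δ₂ := by
      have := (convex_ball (H r) δ₂).ordConnected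
      exact this.uIcc_subset (Metric.mem_ball_self hδ₂) hr3
    have t1 := tendsto_mul_integral_curve (γ := fun x : ℝ => (x + H r * I : ℂ)) hρ hbd
      (by fun_prop) (α := r) (β := r')
      (fun x hx => hball x _ (hsub2 hx) (Metric.mem_ball_self hδ₂))
    have t2 := tendsto_mul_integral_curve (γ := fun y : ℝ => (r' + y * I : ℂ)) hρ hbd
      (by fun_prop) (α := H r) (β := H r') (fun y hy => hball r' y hr2 (hsub3 hy))
    have t3 := t1.add (t2.const_mul I)
    rw [mul_zero, add_zero] at t3
    refine t3.congr fun n => ?_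
    have hrect := integral_boundary_rect_eq_zero_of_differentiableOn (f n) (r : ℂ) (r' + H r * I)
      ((hd n).mono (by
        rintro z ⟨hz1, hz2⟩
        simp only [Set.mem_preimage, add_re, ofReal_re, mul_re, I_re, mul_zero, ofReal_im, I_im,
          mul_one, sub_self, add_zero, add_im, mul_im, zero_add] at hz1 hz2
        rw [← re_add_im z]
        exact h1 _ (hsub1 hz1) _ hz2))
    simp only [add_re, ofReal_re, mul_re, I_re, mul_zero, ofReal_im, I_im, mul_one, sub_self,
      add_zero, add_im, mul_im, zero_add, ofReal_zero, zero_mul, smul_eq_mul] at hrect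
    have hadj := intervalIntegral.integral_add_adjacent_intervals
      (hfi n (γ := fun y : ℝ => (r' + y * I : ℂ)) (by fun_prop) (α := 0) (β := H r)
        (fun y hy => h1 r' hr1 y hy))
      (hfi n (γ := fun y : ℝ => (r' + y * I : ℂ)) (by fun_prop) (α := H r) (β := H r')
        (fun y hy => (hball r' y hr2 (hsub3 hy)).1))
    rw [← hadj]
    linear_combination (-(n : ℂ)) * hrect
  · intro x y z _ _ _ hxy hyz
    have := hxy.add hyz
    rw [add_zero] at this
    refine this.congr fun n => ?_
    rw [← intervalIntegral.integral_add_adjacent_intervals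
      (hfi n continuous_ofReal (α := x) (β := y) fun x _ => hreal x)
      (hfi n continuous_ofReal (α := y) (β := z) fun x _ => hreal x)]
    ring
  · intro x y _ _ hxy
    have := hxy.neg
    rw [neg_zero] at this
    refine this.congr fun n => ?_
    rw [intervalIntegral.integral_symm y x]
    ring

lemma tendsto_sq_mul_cos_sub_one (x : ℝ) :
    Tendsto (fun n : ℝ => n ^ 2 * (Real.cos (x / n) - 1)) atTop (nhds (-(x ^ 2 / 2))) := by
  have hlim : Tendsto (fun n : ℝ => x ^ 4 * (5 / 96) * (n⁻¹) ^ 2) atTop (nhds 0) := by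
    have := (tendsto_inv_atTop_zero (𝕜 := ℝ).pow 2).const_mul (x ^ 4 * (5 / 96))
    rwa [zero_pow two_ne_zero, mul_zero] at this
  rw [tendsto_iff_norm_sub_tendsto_zero]
  refine squeeze_zero' (.of_forall fun _ => norm_nonneg _) ?_ hlim
  filter_upwards [eventually_gt_atTop 0, eventually_ge_atTop |x|] with n hn hxn
  have h1 : |x / n| ≤ 1 := by rw [abs_div, abs_of_pos hn]; exact div_le_one_of_le₀ hxn hn.le
  have h2 := Real.cos_bound h1
  have h3 : n ^ 2 * (Real.cos (x / n) - 1) - -(x ^ 2 / 2) =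
      n ^ 2 * (Real.cos (x / n) - (1 - (x / n) ^ 2 / 2)) := by field_simp; ring
  rw [h3, Real.norm_eq_abs, abs_mul, abs_of_pos (by positivity : 0 < n ^ 2)]
  calc _ ≤ n ^ 2 * (|x / n| ^ 4 * (5 / 96)) := by gcongr
    _ = _ := by
      rw [Even.pow_abs (by decide)]
      field_simp

/-- Laplace's method for the phase `cos r - 1`. -/
lemma tendsto_mul_integral_laplace {c δ C : ℝ} (hc : 0 < c) (hδ : 0 < δ) (hδπ : δ ≤ Real.pi)
    {h : ℝ → ℝ → ℂ} (hcont : ∀ n, ContinuousOn (h n) (Set.Icc (-δ) δ))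
    (hbd : ∀ᶠ n : ℝ in atTop, ∀ r ∈ Set.Icc (-δ) δ, ‖h n r‖ ≤ C) {L : ℂ}
    (hlim : Tendsto (fun p : ℝ × ℝ => h p.1 p.2) (atTop ×ˢ nhds 0) (nhds L)) :
    Tendsto (fun n : ℝ => (n : ℂ) * ∫ r in (-δ)..δ,
      (Real.exp (n ^ 2 * (c * (Real.cos r - 1))) : ℂ) * h n r) atTop
      (nhds ((√(Real.pi / (c / 2)) : ℝ) * L)) := by
  set g : ℝ → ℝ → ℂ := fun n r => (Real.exp (n ^ 2 * (c * (Real.cos r - 1))) : ℂ) * h n r with hg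
  have hgauss : ((√(Real.pi / (c / 2)) : ℝ) * L) = ∫ x : ℝ, (Real.exp (-(c / 2) * x ^ 2) : ℂ) * L := by
    rw [integral_mul_const, integral_complex_ofReal, integral_gaussian]
  have hrew : ∀ᶠ n : ℝ in atTop, (∫ x : ℝ, (Set.Ioc (-(n * δ)) (n * δ)).indicator
      (fun x => g n (x / n)) x) = (n : ℂ) * ∫ r in (-δ)..δ, g n r := by
    filter_upwards [eventually_gt_atTop 0] with n hn
    rw [integral_indicator measurableSet_Ioc, ← intervalIntegral.integral_of_le (by nlinarith),
      intervalIntegral.integral_comp_div _ hn.ne', Complex.real_smul]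
    congr 2 <;> field_simp
  have hmem : ∀ {n x : ℝ}, 0 < n → x ∈ Set.Ioc (-(n * δ)) (n * δ) → x / n ∈ Set.Icc (-δ) δ := by
    intro n x hn hx
    rw [Set.mem_Icc, le_div_iff₀ hn, div_le_iff₀ hn]
    constructor <;> nlinarith [hx.1, hx.2]
  rw [hgauss]
  refine Tendsto.congr' hrew ?_
  refine tendsto_integral_filter_of_dominated_convergence
    (fun x => Real.exp (-(c * (2 / Real.pi ^ 2)) * x ^ 2) * |C|) ?_ ?_ ?_ ?_
  · filter_upwards [eventually_gt_atTop 0] with n hn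
    rw [aestronglyMeasurable_indicator_iff measurableSet_Ioc]
    refine ContinuousOn.aestronglyMeasurable ?_ measurableSet_Ioc
    refine ContinuousOn.mul (by fun_prop) ?_
    exact (hcont n).comp (by fun_prop) fun x hx => hmem hn hx
  · filter_upwards [eventually_gt_atTop 0, hbd] with n hn hb
    refine .of_forall fun x => ?_
    by_cases hx : x ∈ Set.Ioc (-(n * δ)) (n * δ)
    · rw [Set.indicator_of_mem hx, hg, norm_mul, Complex.norm_real, Real.norm_of_nonneg
        (Real.exp_pos _).le]
      have hm := hmem hn hx
      refine mul_le_mul (Real.exp_le_exp.2 ?_) ((hb _ hm).trans (le_abs_self C)) (norm_nonneg _)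
        (Real.exp_pos _).le
      have hcos := Real.cos_le_one_sub_mul_cos_sq ((abs_le.2 hm).trans hδπ)
      have : n ^ 2 * (c * (Real.cos (x / n) - 1)) ≤ n ^ 2 * (c * (-(2 / Real.pi ^ 2 * (x / n) ^ 2))) := by
        gcongr
        linarith
      refine this.trans_eq ?_
      field_simp
    · rw [Set.indicator_of_notMem hx, norm_zero]
      positivity
  · exact (integrable_exp_neg_mul_sq (by positivity)).mul_const _
  · refine .of_forall fun x => ?_
    have hx0 : Tendsto (fun n : ℝ => x / n) atTop (nhds 0) := tendsto_const_nhds.div_atTop tendsto_id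
    have hh : Tendsto (fun n : ℝ => h n (x / n)) atTop (nhds L) :=
      hlim.comp (tendsto_id.prodMk hx0)
    have he : Tendsto (fun n : ℝ => n ^ 2 * (c * (Real.cos (x / n) - 1))) atTop
        (nhds (-(c / 2) * x ^ 2)) := by
      convert (tendsto_sq_mul_cos_sub_one x).const_mul c using 2 <;> ring
    have hprod := ((continuous_ofReal.comp Real.continuous_exp).tendsto _ |>.comp he).mul hh
    refine hprod.congr' ?_
    filter_upwards [eventually_gt_atTop (|x| / δ)] with n hn
    have h2 : |x| < n * δ := by rwa [div_lt_iff₀ hδ] at hn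
    rw [Set.indicator_of_mem (Set.Ioo_subset_Ioc_self (abs_lt.1 h2))]
    rfl

lemma arcosh_inv_cos {r : ℝ} (hr : 0 < Real.cos r) :
    Real.arcosh (1 / Real.cos r) = -Real.log ((1 - |Real.sin r|) / Real.cos r) := by
  have hsq := Real.sin_sq_add_cos_sq r
  have h1 : (1 / Real.cos r) ^ 2 - 1 = (|Real.sin r| / Real.cos r) ^ 2 := by
    rw [div_pow, div_pow, sq_abs]
    field_simp
    linarith
  have h2 : (1 - |Real.sin r|) * (1 + |Real.sin r|) = Real.cos r ^ 2 := by
    linear_combination -sq_abs (Real.sin r) - hsq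
  have h3 : 0 < 1 - |Real.sin r| := by
    have := sq_abs (Real.sin r)
    nlinarith [abs_nonneg (Real.sin r), sq_pos_of_pos hr]
  rw [Real.arcosh, h1, Real.sqrt_sq (by positivity), ← Real.log_inv, inv_div]
  congr 1
  rw [← add_div, div_eq_div_iff hr.ne' h3.ne']
  linear_combination h2

lemma arcosh_div_sqrt {a b : ℝ} (hb : 0 < b) (hab : b < a) :
    Real.arcosh (a / √(a ^ 2 - b ^ 2)) = Real.log √((a + b) / (a - b)) := by
  have h0 : 0 < a ^ 2 - b ^ 2 := by nlinarith
  have h1 : (a / √(a ^ 2 - b ^ 2)) ^ 2 - 1 = (b / √(a ^ 2 - b ^ 2)) ^ 2 := by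
    rw [div_pow, div_pow, Real.sq_sqrt h0.le]
    field_simp
    ring
  rw [Real.arcosh, h1, Real.sqrt_sq (by positivity), ← add_div]
  congr 1
  symm
  rw [Real.sqrt_eq_iff_mul_self_eq (div_nonneg (by linarith) (by linarith))
    (div_nonneg (by linarith) (Real.sqrt_nonneg _)), ← sq, div_pow, Real.sq_sqrt h0.le,
    div_eq_div_iff (by linarith) h0.ne']
  ring

lemma mem_ellT0 {a b r y : ℝ} (hb : 0 < b) (hab : b < a) (hr : |r| ≤ Real.pi)
    (hcos : √(a ^ 2 - b ^ 2) / a ≤ Real.cos r) (hy0 : 0 ≤ y)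
    (hy : y ≤ Real.arcosh (a / √(a ^ 2 - b ^ 2)) - Real.arcosh (1 / Real.cos r)) :
    (r + y * I : ℂ) ∈ ellT0 a b := by
  have ha := hb.trans hab
  have h0 : 0 < a ^ 2 - b ^ 2 := by nlinarith
  have hc0 : 0 < Real.cos r := lt_of_lt_of_le (div_pos (Real.sqrt_pos.2 h0) ha) hcos
  have hs : 1 - |Real.sin r| ≠ 0 := by
    have := sq_abs (Real.sin r)
    have := Real.sin_sq_add_cos_sq r
    intro h
    have : |Real.sin r| = 1 := by linarith
    nlinarith [sq_pos_of_pos hc0]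
  have e : √(1 - b ^ 2 / a ^ 2) = √(a ^ 2 - b ^ 2) / a := by
    rw [one_sub_div (by positivity), Real.sqrt_div' _ (by positivity), Real.sqrt_sq ha.le]
  refine ⟨?_, ?_, ?_⟩
  · have := Real.arccos_le_arccos hcos
    rw [← Real.cos_abs, Real.arccos_cos (abs_nonneg r) hr] at this
    simpa [e] using this
  · simpa using hy0
  · rw [arcosh_inv_cos hc0, arcosh_div_sqrt hb hab] at hy
    have hab' : 0 < (a + b) / (a - b) := div_pos (by linarith) (by linarith)
    have : Real.log ((1 - |Real.sin r|) / Real.cos r * √((a + b) / (a - b))) =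
        Real.log ((1 - |Real.sin r|) / Real.cos r) + Real.log √((a + b) / (a - b)) :=
      Real.log_mul (div_ne_zero hs hc0.ne') (Real.sqrt_pos.2 hab').ne'
    simp only [add_re, ofReal_re, mul_re, I_re, mul_zero, ofReal_im, I_im, mul_one, sub_self,
      add_zero, add_im, mul_im, zero_add]
    linarith

/-- The height of a contour inside an open set `N` from `-π` to `π`, passing through `I * s₀` and
otherwise below the level `cos r * cosh (y - s₀) = 1`. -/
lemma exists_contour_height {κ s₀ : ℝ} (hκ : 0 < κ) (hs₀ : s₀ = Real.arcosh (1 / κ)) (hκ1 : κ < 1)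
    {N : Set ℂ} (hNo : IsOpen N) (hreal : ∀ x : ℝ, (x : ℂ) ∈ N)
    (hT : ∀ r y : ℝ, |r| ≤ Real.pi → κ ≤ Real.cos r → 0 ≤ y →
      y ≤ s₀ - Real.arcosh (1 / Real.cos r) → (r + y * I : ℂ) ∈ N) :
    ∃ (H : ℝ → ℝ) (δ : ℝ), Continuous H ∧ 0 < δ ∧ δ < Real.pi ∧
      (∀ r : ℝ, |r| ≤ Real.pi → ∀ y ∈ Set.uIcc 0 (H r), (r + y * I : ℂ) ∈ N) ∧
      (∀ r : ℝ, Real.cos r < 1 → Real.cos r * Real.cosh (H r - s₀) < 1) ∧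
      (∀ r : ℝ, |r| ≤ δ → H r = s₀) ∧ H Real.pi = 0 ∧ H (-Real.pi) = 0 := by
  have hκ' : 1 < 1 / κ := by rwa [lt_div_iff₀ hκ, one_mul]
  have hs₀' : 0 < s₀ := hs₀ ▸ Real.arcosh_pos hκ'
  have hM : ∀ r, κ / 2 ≤ max (Real.cos r) (κ / 2) ∧ max (Real.cos r) (κ / 2) ≤ 1 := fun r =>
    ⟨le_max_right _ _, max_le (Real.cos_le_one r) (by linarith)⟩
  have hM0 : ∀ r, 0 < max (Real.cos r) (κ / 2) := fun r => lt_of_lt_of_le (by positivity) (hM r).1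
  have hM1 : ∀ r, 1 ≤ 1 / max (Real.cos r) (κ / 2) := fun r => by
    rw [le_div_iff₀ (hM0 r), one_mul]
    exact (hM r).2
  set G : ℝ → ℝ := fun r => Real.arcosh (1 / max (Real.cos r) (κ / 2)) with hG
  have hGc : Continuous G := Real.continuousOn_arcosh.comp_continuous
    (continuous_const.div (by fun_prop) fun r => (hM0 r).ne') fun r => hM1 r
  have hG0 : ∀ r, 0 ≤ G r := fun r => Real.arcosh_nonneg (hM1 r)
  have hGπ : s₀ < G Real.pi := by
    have : max (Real.cos Real.pi) (κ / 2) = κ / 2 := by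
      rw [Real.cos_pi]
      exact max_eq_right (by linarith)
    rw [hG, hs₀]
    simp only [this]
    rw [Real.arcosh_lt_arcosh (by positivity) (by positivity)]
    exact one_div_lt_one_div_of_lt (by positivity) (by linarith)
  have hNo' : IsOpen {p : ℝ × ℝ | (p.1 + p.2 * I : ℂ) ∈ N} := hNo.preimage (by fun_prop)
  have hZc : IsCompact {p : ℝ × ℝ | |p.1| ≤ Real.pi ∧ 0 ≤ p.2 ∧ p.2 ≤ max 0 (s₀ - G p.1)} := by
    refine IsCompact.of_isClosed_subset
      ((isCompact_Icc (a := -Real.pi) (b := Real.pi)).prod (isCompact_Icc (a := 0) (b := s₀))) ?_ ?_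
    · exact (isClosed_le (f := fun p : ℝ × ℝ => |p.1|) (by fun_prop) continuous_const).inter
        ((isClosed_le continuous_const continuous_snd).inter
          (isClosed_le (g := fun p : ℝ × ℝ => max 0 (s₀ - G p.1)) continuous_snd (by fun_prop)))
    · rintro ⟨r, y⟩ ⟨h1, h2, h3⟩
      exact ⟨abs_le.1 h1, h2, h3.trans (max_le hs₀'.le (by linarith [hG0 r]))⟩
  have hZN : {p : ℝ × ℝ | |p.1| ≤ Real.pi ∧ 0 ≤ p.2 ∧ p.2 ≤ max 0 (s₀ - G p.1)} ⊆
      {p : ℝ × ℝ | (p.1 + p.2 * I : ℂ) ∈ N} := by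
    rintro ⟨r, y⟩ ⟨h1, h2, h3⟩
    simp only at h1 h2 h3
    rcases h2.eq_or_lt with rfl | h2
    · simpa using hreal r
    · have h4 : y ≤ s₀ - G r := (le_max_iff.1 h3).resolve_left (not_le.2 h2)
      have h5 : G r < s₀ := by linarith
      rw [hs₀, hG, Real.arcosh_lt_arcosh (by have := hM0 r; positivity) (by positivity),
        one_div_lt_one_div (hM0 r) hκ, lt_max_iff] at h5
      have h6 : κ < Real.cos r := h5.resolve_right (by linarith)
      have h7 : G r = Real.arcosh (1 / Real.cos r) := by
        simp only [hG]
        rw [max_eq_left (by linarith)]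
      exact hT r y h1 h6.le h2.le (h7 ▸ h4)
  obtain ⟨ε₀, hε₀, hε₀N⟩ := hZc.exists_cthickening_subset_open hNo' hZN
  set ε := min ε₀ (G Real.pi - s₀) with hε
  have hε0 : 0 < ε := lt_min hε₀ (by linarith)
  set H : ℝ → ℝ := fun r => max 0 (min s₀ (s₀ - G r + ε)) with hH
  obtain ⟨δ, hδ, hδG⟩ := Metric.eventually_nhds_iff_ball.1 (hGc.continuousAt.eventually_lt
    continuousAt_const (show G 0 < ε by
      have : G 0 = 0 := by
        simp only [hG, Real.cos_zero]
        rw [max_eq_left (by linarith)]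
        simp [Real.arcosh]
      rwa [this]))
  refine ⟨H, min (δ / 2) (Real.pi / 2), by fun_prop, lt_min (by positivity) (by positivity),
    (min_le_right _ _).trans_lt (by linarith [Real.pi_pos]), ?_, ?_, ?_, ?_, ?_⟩
  · intro r hr y hy
    have hH0 : 0 ≤ H r := le_max_left _ _
    rw [Set.uIcc_of_le hH0] at hy
    refine hε₀N (Metric.mem_cthickening_of_dist_le (r, y) (r, max 0 (y - ε)) ε₀ _
      ⟨hr, le_max_left _ _, ?_⟩ ?_)
    · rcases le_max_iff.1 hy.2 with h | h
      · exact max_le (le_max_left _ _) ((by linarith : y - ε ≤ 0).trans (le_max_left _ _))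
      · exact max_le_max le_rfl (by linarith [min_le_right s₀ (s₀ - G r + ε)])
    · rw [Prod.dist_eq, dist_self]
      refine max_le hε₀.le ?_
      rw [Real.dist_eq, abs_le]
      have := min_le_left ε₀ (G Real.pi - s₀)
      rcases max_cases 0 (y - ε) with ⟨h1, h2⟩ | ⟨h1, h2⟩ <;> rw [h1] <;>
        constructor <;> linarith [hy.1]
  · intro r hr
    rcases le_or_gt (Real.cos r) 0 with h0 | h0
    · nlinarith [Real.cosh_pos (H r - s₀)]
    · have hGpos : 0 < G r := Real.arcosh_pos (by
        rw [lt_div_iff₀ (hM0 r), one_mul]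
        exact max_lt hr (by linarith))
      have hlt : |H r - s₀| < |G r| := by
        rw [abs_of_pos hGpos, abs_lt]
        simp only [hH]
        constructor
        · rcases le_total s₀ (s₀ - G r + ε) with h | h
          · rw [min_eq_left h, max_eq_right hs₀'.le]; linarith
          · rw [min_eq_right h]; linarith [le_max_right 0 (s₀ - G r + ε)]
        · linarith [max_le hs₀'.le (min_le_left s₀ (s₀ - G r + ε))]
      rw [← Real.cosh_lt_cosh, Real.cosh_arcosh (hM1 r), lt_div_iff₀ (hM0 r)] at hlt
      nlinarith [Real.cosh_pos (H r - s₀), le_max_left (Real.cos r) (κ / 2)]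
  · intro r hr
    have : G r < ε := hδG r (by
      rw [Metric.mem_ball, dist_zero_right, Real.norm_eq_abs]
      linarith [min_le_left (δ / 2) (Real.pi / 2)])
    simp only [hH]
    rw [min_eq_left (by linarith), max_eq_right hs₀'.le]
  · simp only [hH]
    exact max_eq_left ((min_le_right _ _).trans (by linarith [min_le_right ε₀ (G Real.pi - s₀)]))
  · simp only [hH]
    have : G (-Real.pi) = G Real.pi := by simp [hG]
    rw [this]
    exact max_eq_left ((min_le_right _ _).trans (by linarith [min_le_right ε₀ (G Real.pi - s₀)]))

/-- If integrals with phase `cos (z - I * s₀) - 1` vanish, then so does the limit amplitude at the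
saddle point `I * s₀`. -/
lemma saddle_amplitude_eq_zero {c κ s₀ : ℝ} (hc : 0 < c) (hκ : 0 < κ)
    (hs₀ : s₀ = Real.arcosh (1 / κ)) (hκ1 : κ < 1)
    {N : Set ℂ} (hNo : IsOpen N) (hreal : ∀ x : ℝ, (x : ℂ) ∈ N)
    (hT : ∀ r y : ℝ, |r| ≤ Real.pi → κ ≤ Real.cos r → 0 ≤ y →
      y ≤ s₀ - Real.arcosh (1 / Real.cos r) → (r + y * I : ℂ) ∈ N)
    {h : ℝ → ℂ → ℂ} (hd : ∀ n, DifferentiableOn ℂ (h n) N)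
    (hbd : ∀ K ⊆ N, IsCompact K → ∃ C : ℝ, ∀ᶠ n : ℝ in atTop, ∀ z ∈ K, ‖h n z‖ ≤ C) {L : ℂ}
    (hlim : Tendsto (fun p : ℝ × ℂ => h p.1 p.2) (atTop ×ˢ nhds (s₀ * I)) (nhds L))
    (h0 : ∀ᶠ n : ℝ in atTop, ∫ t in (-Real.pi)..Real.pi,
      cexp ((n ^ 2 : ℝ) * (c * (cos (t - s₀ * I) - 1))) * h n t = 0) : L = 0 := by
  obtain ⟨H, δ, hH, hδ, hδπ, hHN, hHneg, hHδ, hHπ, hHπ'⟩ :=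
    exists_contour_height hκ hs₀ hκ1 hNo hreal hT
  have hs₀0 : 0 < s₀ := hs₀ ▸ Real.arcosh_pos (by rwa [lt_div_iff₀ hκ, one_mul])
  set f : ℝ → ℂ → ℂ := fun n z => cexp ((n ^ 2 : ℝ) * (c * (cos (z - s₀ * I) - 1))) * h n z with hf
  set ρ : ℂ → ℝ := fun z => c * ((cos (z - s₀ * I)).re - 1) with hρ
  have hρc : Continuous ρ := by fun_prop
  have hcos : ∀ r y : ℝ, cos ((r : ℂ) + y * I - s₀ * I) =
      (Real.cos r * Real.cosh (y - s₀) : ℝ) - (Real.sin r * Real.sinh (y - s₀) : ℝ) * I := by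
    intro r y
    rw [show (r : ℂ) + y * I - s₀ * I = r + ((y - s₀ : ℝ) : ℂ) * I by push_cast; ring, cos_add_mul_I]
    push_cast
    ring
  have hρv : ∀ r y : ℝ, ρ (r + y * I) = c * (Real.cos r * Real.cosh (y - s₀) - 1) := by
    intro r y
    simp only [hρ]
    rw [hcos, sub_re, ofReal_re, re_ofReal_mul, I_re, mul_zero, sub_zero]
  have hfd : ∀ n, DifferentiableOn ℂ (f n) N := fun n =>
    DifferentiableOn.mul (by fun_prop) (hd n)
  have hfn : ∀ n z, ‖f n z‖ = Real.exp (n ^ 2 * ρ z) * ‖h n z‖ := by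
    intro n z
    simp only [hf, hρ]
    rw [norm_mul, norm_exp, re_ofReal_mul, re_ofReal_mul, sub_re, one_re]
  have hfb : ∀ K ⊆ N, IsCompact K → ∃ C : ℝ, ∀ᶠ n : ℝ in atTop, ∀ z ∈ K,
      ‖f n z‖ ≤ C * Real.exp (n ^ 2 * ρ z) := by
    intro K hKN hK
    obtain ⟨C, hC⟩ := hbd K hKN hK
    refine ⟨C, hC.mono fun n hn z hz => ?_⟩
    rw [hfn, mul_comm C]
    exact mul_le_mul_of_nonneg_left (hn z hz) (Real.exp_pos _).le
  have hneg : ∀ r : ℝ, Real.cos r < 1 → ρ (r + H r * I) < 0 := fun r hr => by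
    rw [hρv]
    exact mul_neg_of_pos_of_neg hc (by linarith [hHneg r hr])
  have hcos1 : ∀ r : ℝ, δ ≤ |r| → |r| ≤ Real.pi → Real.cos r < 1 := fun r h1 h2 => by
    rw [← Real.cos_abs, ← Real.cos_zero]
    exact Real.cos_lt_cos_of_nonneg_of_le_pi le_rfl h2 (hδ.trans_le h1)
  have habs : ∀ r ∈ Set.Icc δ Real.pi, δ ≤ |r| ∧ |r| ≤ Real.pi := fun r hr => by
    rw [abs_of_pos (hδ.trans_le hr.1)]
    exact hr
  have habs' : ∀ r ∈ Set.Icc (-Real.pi) (-δ), δ ≤ |r| ∧ |r| ≤ Real.pi := fun r hr => by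
    rw [abs_of_neg (by linarith [hr.2])]
    exact ⟨by linarith [hr.2], by linarith [hr.1]⟩
  have right := tendsto_mul_contour hNo hreal hfd hρc hfb hH (S := Set.Icc δ Real.pi)
    isPreconnected_Icc (fun r hr => hHN r (habs r hr).2)
    (fun r hr => hneg r (hcos1 r (habs r hr).1 (habs r hr).2))
    (Set.left_mem_Icc.2 hδπ.le) (Set.right_mem_Icc.2 hδπ.le)
  have left := tendsto_mul_contour hNo hreal hfd hρc hfb hH (S := Set.Icc (-Real.pi) (-δ))
    isPreconnected_Icc (fun r hr => hHN r (habs' r hr).2)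
    (fun r hr => hneg r (hcos1 r (habs' r hr).1 (habs' r hr).2))
    (Set.left_mem_Icc.2 (by linarith)) (Set.right_mem_Icc.2 (by linarith))
  have hrN : ∀ r ∈ Set.Icc (-δ) δ, ∀ y ∈ Set.Icc 0 s₀, (r + y * I : ℂ) ∈ N := by
    intro r hr y hy
    have hr' := abs_le.2 hr
    refine hHN r (hr'.trans hδπ.le) y ?_
    rwa [hHδ r hr', Set.uIcc_of_le hs₀0.le]
  simp only [hHπ, hHδ δ (abs_of_pos hδ).le, intervalIntegral.integral_same, mul_zero,
    add_zero] at right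
  simp only [hHπ', hHδ (-δ) (by rw [abs_neg, abs_of_pos hδ]), intervalIntegral.integral_same,
    mul_zero, sub_zero] at left
  have top : Tendsto (fun n : ℝ => (n : ℂ) * ∫ r in (-δ)..δ, f n (r + s₀ * I)) atTop (nhds 0) := by
    have := (left.add right).neg
    rw [add_zero, neg_zero] at this
    refine this.congr' ?_
    filter_upwards [h0] with n hn
    have hii : ∀ α β : ℝ, IntervalIntegrable (fun x : ℝ => f n x) volume α β := fun α β =>
      ((hfd n).continuousOn.comp continuous_ofReal.continuousOn
        (fun x _ => hreal x)).intervalIntegrable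
    have hrect := integral_boundary_rect_eq_zero_of_differentiableOn (f n) ((-δ : ℝ) : ℂ)
      (δ + s₀ * I) ((hfd n).mono (by
        rintro z ⟨hz1, hz2⟩
        simp only [Set.mem_preimage, add_re, ofReal_re, mul_re, I_re, mul_zero, ofReal_im, I_im,
          mul_one, sub_self, add_zero, add_im, mul_im, zero_add] at hz1 hz2
        rw [Set.uIcc_of_le (by linarith)] at hz1
        rw [Set.uIcc_of_le hs₀0.le] at hz2
        rw [← re_add_im z]
        exact hrN _ hz1 _ hz2))
    simp only [add_re, ofReal_re, mul_re, I_re, mul_zero, ofReal_im, I_im, mul_one, sub_self,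
      add_zero, add_im, mul_im, zero_add, ofReal_zero, zero_mul, smul_eq_mul] at hrect
    rw [← intervalIntegral.integral_add_adjacent_intervals (hii _ (-δ)) (hii _ _),
      ← intervalIntegral.integral_add_adjacent_intervals (hii (-δ) δ) (hii _ _)] at hn
    linear_combination (n : ℂ) * hrect - (n : ℂ) * hn
  have hline : ∀ n r : ℝ, f n (r + s₀ * I) =
      (Real.exp (n ^ 2 * (c * (Real.cos r - 1))) : ℂ) * h n (r + s₀ * I) := by
    intro n r
    simp only [hf]
    rw [hcos]
    simp
  have hmaps : Set.MapsTo (fun r : ℝ => (r + s₀ * I : ℂ)) (Set.Icc (-δ) δ) N := fun r hr =>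
    hrN r hr s₀ (Set.right_mem_Icc.2 hs₀0.le)
  obtain ⟨C, hC⟩ := hbd ((fun r : ℝ => (r + s₀ * I : ℂ)) '' Set.Icc (-δ) δ) hmaps.image_subset
    (isCompact_Icc.image (by fun_prop))
  have hlap := tendsto_mul_integral_laplace hc hδ hδπ.le (h := fun n r => h n (r + s₀ * I))
    (fun n => (hd n).continuousOn.comp (by fun_prop) hmaps)
    (hC.mono fun n hn r hr => hn _ (Set.mem_image_of_mem _ hr))
    (hlim.comp (tendsto_fst.prodMk (((by fun_prop : Continuous fun r : ℝ => (r + s₀ * I : ℂ)).tendsto'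
      0 (s₀ * I) (by simp)).comp tendsto_snd)))
  simp only [← hline] at hlap
  have hL := tendsto_nhds_unique hlap top
  refine (mul_eq_zero.1 hL).resolve_left (ofReal_ne_zero.2 ?_)
  have := Real.pi_pos
  positivity

lemma sqrt_sub_sq_add {K l : ℝ} (hK : 0 ≤ K) :
    (√(l ^ 2 + K) - l) ^ 2 + 2 * (l * (√(l ^ 2 + K) - l)) = K := by
  linear_combination Real.sq_sqrt (by positivity : 0 ≤ l ^ 2 + K)

lemma tendsto_sqrt_add_sub {K : ℝ} (hK : 0 ≤ K) :
    Tendsto (fun l : ℝ => (√(l ^ 2 + K) - l, l * (√(l ^ 2 + K) - l))) atTop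
      (nhds (0, K / 2)) := by
  have h1 : Tendsto (fun l : ℝ => √(l ^ 2 + K) - l) atTop (nhds 0) := by
    refine squeeze_zero' ?_ ?_ ((tendsto_const_nhds (x := K)).div_atTop tendsto_id)
    · filter_upwards with l
      exact sub_nonneg.2 (Real.le_sqrt_of_sq_le (by linarith))
    · filter_upwards [eventually_gt_atTop 0] with l hl
      rw [id, le_div_iff₀ hl]
      have h2 : 0 ≤ √(l ^ 2 + K) - l := sub_nonneg.2 (Real.le_sqrt_of_sq_le (by linarith))
      nlinarith [sqrt_sub_sq_add (l := l) hK, mul_nonneg hl.le h2, sq_nonneg (√(l ^ 2 + K) - l)]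
  refine h1.prodMk_nhds ?_
  have h2 : Tendsto (fun l : ℝ => (K - (√(l ^ 2 + K) - l) ^ 2) / 2) atTop (nhds (K / 2)) := by
    simpa using ((h1.pow 2).const_sub K).div_const 2
  refine h2.congr fun l => ?_
  linarith [sqrt_sub_sq_add (l := l) hK]

lemma continuousAt_ellAmp {U : ℂ → ℂ → ℂ} {a b : ℝ} {p : ℝ × ℝ} {t : ℂ}
    (hU : AnalyticAt ℂ (fun p : ℂ × ℂ => U p.1 p.2) (a * cos t, b * sin t)) :
    ContinuousAt (fun x : (ℝ × ℝ) × ℂ => ellAmp U a b x.1.1 x.1.2 x.2) (p, t) := by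
  have hc : ∀ {V : ℂ → ℂ → ℂ}, AnalyticAt ℂ (fun p : ℂ × ℂ => V p.1 p.2) (a * cos t, b * sin t) →
      ContinuousAt (fun x : (ℝ × ℝ) × ℂ => V (a * cos x.2) (b * sin x.2)) (p, t) := fun {V} hV =>
    ContinuousAt.comp (x := (p, t)) (g := fun p : ℂ × ℂ => V p.1 p.2)
      (f := fun x : (ℝ × ℝ) × ℂ => ((a : ℂ) * cos x.2, (b : ℂ) * sin x.2)) hV.continuousAt (by fun_prop)
  have c0 := hc hU
  have c1 := hc hU.partial_fst
  have c2 := hc hU.partial_snd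
  have c11 := hc hU.partial_fst.partial_fst
  have c12 := hc hU.partial_snd.partial_fst
  have c21 := hc hU.partial_fst.partial_snd
  have c22 := hc hU.partial_snd.partial_snd
  have hI : ContinuousAt (fun _ : (ℝ × ℝ) × ℂ => I) (p, t) := continuousAt_const
  refine ((hI.mul (((c11.sub (hI.mul c12)).mul ?_).add ((c21.sub (hI.mul c22)).mul ?_))).sub
    (ContinuousAt.mul ?_ (c1.sub (hI.mul c2)))).add ((ContinuousAt.mul ?_ c0).mul ?_)
  all_goals fun_prop

lemma differentiableAt_ellAmp {U : ℂ → ℂ → ℂ} {a b e m : ℝ} {t : ℂ}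
    (hU : AnalyticAt ℂ (fun p : ℂ × ℂ => U p.1 p.2) (a * cos t, b * sin t)) :
    DifferentiableAt ℂ (ellAmp U a b e m) t := by
  have hc : ∀ {V : ℂ → ℂ → ℂ}, AnalyticAt ℂ (fun p : ℂ × ℂ => V p.1 p.2) (a * cos t, b * sin t) →
      DifferentiableAt ℂ (fun t : ℂ => V (a * cos t) (b * sin t)) t := fun hV =>
    DifferentiableAt.comp (f := fun t : ℂ => ((a : ℂ) * cos t, (b : ℂ) * sin t)) t
      hV.differentiableAt (by fun_prop)
  have c0 := hc hU
  have c1 := hc hU.partial_fst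
  have c2 := hc hU.partial_snd
  have c11 := hc hU.partial_fst.partial_fst
  have c12 := hc hU.partial_snd.partial_fst
  have c21 := hc hU.partial_fst.partial_snd
  have c22 := hc hU.partial_snd.partial_snd
  refine ((((c11.sub (c12.const_mul I)).mul ?_).add ((c21.sub (c22.const_mul I)).mul ?_)).const_mul
    I |>.sub (DifferentiableAt.mul ?_ (c1.sub (c2.const_mul I)))).add
    ((DifferentiableAt.mul ?_ c0).mul ?_)
  all_goals fun_prop

theorem stmt3
    (a b k q : ℝ) (hb : 0 < b) (hab : b < a) (hk : 0 < k) (hq : 0 < q) (hq1 : q ≠ 1)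
    (U : ℂ → ℂ → ℂ) (Ω : Set (ℂ × ℂ)) (hΩ : IsOpen Ω)
    (hΩR : ∀ p : ℝ × ℝ, ((p.1 : ℂ), (p.2 : ℂ)) ∈ Ω)
    (hΩT : ∀ t ∈ ellT0 a b, ((a : ℂ) * Complex.cos t, (b : ℂ) * Complex.sin t) ∈ Ω)
    (hUan : ∀ p ∈ Ω, AnalyticAt ℂ (fun p : ℂ × ℂ => U p.1 p.2) p)
    (hHelm : ∀ p ∈ Ω, P1 (P1 U) p.1 p.2 + P2 (P2 U) p.1 p.2 + (k : ℂ) ^ 2 * U p.1 p.2 = 0)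
    (hvanish : ∀ lam : ℝ, 0 < lam →
      (∫ p in {p : ℝ × ℝ | p.1 ^ 2 / a ^ 2 + p.2 ^ 2 / b ^ 2 < 1},
        U (p.1 : ℂ) (p.2 : ℂ) *
          Complex.exp ((lam : ℂ) * (p.1 : ℂ)
            + Complex.I * ((Real.sqrt (lam ^ 2 + k ^ 2 * q) : ℝ) : ℂ) * (p.2 : ℂ))) = 0) :
    U ((a ^ 2 / Real.sqrt (a ^ 2 - b ^ 2) : ℝ) : ℂ)
      (Complex.I * ((b ^ 2 / Real.sqrt (a ^ 2 - b ^ 2) : ℝ) : ℂ)) = 0 := by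
  have ha := hb.trans hab
  have hab2 : 0 < a ^ 2 - b ^ 2 := by nlinarith
  have hK : 0 < k ^ 2 * q := by positivity
  set c := √(a ^ 2 - b ^ 2) with hc
  have hc0 : 0 < c := Real.sqrt_pos.2 hab2
  have hc2 : c ^ 2 = a ^ 2 - b ^ 2 := Real.sq_sqrt hab2.le
  have hca : c < a := by nlinarith
  have hac : 1 ≤ a / c := by rw [le_div_iff₀ hc0]; linarith
  set s₀ := Real.arcosh (a / c) with hs₀
  have hcosh : cos (s₀ * I) = a / c := by
    rw [cos_mul_I, ← ofReal_cosh, Real.cosh_arcosh hac]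
    push_cast
    ring
  have hsinh : sin (s₀ * I) = b / c * I := by
    have : (a / c) ^ 2 - 1 = (b / c) ^ 2 := by
      field_simp
      linarith
    rw [sin_mul_I, ← ofReal_sinh, Real.sinh_arcosh hac, this, Real.sqrt_sq (by positivity)]
    push_cast
    ring
  have hcC : (c : ℂ) ≠ 0 := ofReal_ne_zero.2 hc0.ne'
  have hphase : ∀ z : ℂ, a * cos z + I * (b * sin z) = c * cos (z - s₀ * I) := by
    intro z
    rw [cos_sub, hcosh, hsinh]
    field_simp
  set N : Set ℂ := {t | ((a : ℂ) * cos t, (b : ℂ) * sin t) ∈ Ω} with hN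
  have hNo : IsOpen N := hΩ.preimage (by fun_prop)
  have hreal : ∀ x : ℝ, (x : ℂ) ∈ N := fun x => by
    have := hΩR (a * Real.cos x, b * Real.sin x)
    push_cast at this
    exact this
  have hT : ∀ r y : ℝ, |r| ≤ Real.pi → c / a ≤ Real.cos r → 0 ≤ y →
      y ≤ s₀ - Real.arcosh (1 / Real.cos r) → (r + y * I : ℂ) ∈ N :=
    fun r y hr hcr hy0 hy => hΩT _ (mem_ellT0 hb hab hr hcr hy0 hy)
  have hs₀N : s₀ * I ∈ N := by
    have := hT 0 s₀ (by simpa using Real.pi_pos.le)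
      (by rw [Real.cos_zero, div_le_one ha]; exact hca.le) (Real.arcosh_nonneg hac)
      (by simp [Real.arcosh])
    simpa using this
  set w : ℝ → ℝ × ℝ := fun n => (√((n ^ 2) ^ 2 + k ^ 2 * q) - n ^ 2,
    n ^ 2 * (√((n ^ 2) ^ 2 + k ^ 2 * q) - n ^ 2)) with hw
  have hwlim : Tendsto w atTop (nhds (0, k ^ 2 * q / 2)) :=
    (tendsto_sqrt_add_sub hK.le).comp (tendsto_pow_atTop two_ne_zero)
  set g : (ℝ × ℝ) × ℂ → ℂ := fun x =>
    cexp (I * x.1.1 * (b * sin x.2)) * ellAmp U a b x.1.1 x.1.2 x.2 with hg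
  have hgc : ∀ p, ∀ t ∈ N, ContinuousAt g (p, t) := fun p t ht =>
    ContinuousAt.mul (by fun_prop) (continuousAt_ellAmp (hUan _ ht))
  have hamp : g ((0, k ^ 2 * q / 2), s₀ * I) = 0 := by
    refine saddle_amplitude_eq_zero (κ := c / a) (N := N) (h := fun n t => g (w n, t)) hc0
      (by positivity) (by rw [one_div_div]) (by rwa [div_lt_one ha]) hNo hreal hT ?_ ?_ ?_ ?_
    · intro n t ht
      have : DifferentiableAt ℂ (fun t => cexp (I * ((w n).1 : ℂ) * (b * sin t))) t := by fun_prop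
      exact (this.mul (differentiableAt_ellAmp (hUan _ ht))).differentiableWithinAt
    · intro K hKN hKc
      obtain ⟨C, hC⟩ := ((isCompact_closedBall ((0 : ℝ), k ^ 2 * q / 2) 1).prod
        hKc).exists_bound_of_continuousOn (f := g) fun x hx =>
          (hgc x.1 x.2 (hKN hx.2)).continuousWithinAt
      refine ⟨C, ?_⟩
      filter_upwards [hwlim (Metric.closedBall_mem_nhds _ one_pos)] with n hn t ht
      exact hC (w n, t) ⟨hn, ht⟩
    · refine (hgc _ _ hs₀N).tendsto.comp ?_
      rw [nhds_prod_eq]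
      exact (hwlim.comp tendsto_fst).prodMk tendsto_snd
    · filter_upwards [eventually_gt_atTop 0] with n hn
      have hzero := integral_ellAmp_eq_zero (mu := √((n ^ 2) ^ 2 + k ^ 2 * q)) ha hb (by positivity)
        (Real.sq_sqrt (by positivity)) hΩR hUan hHelm (hvanish (n ^ 2) (by positivity))
      rw [← mul_zero (cexp (-((n ^ 2 : ℝ) * c))), ← hzero, ← intervalIntegral.integral_const_mul]
      refine intervalIntegral.integral_congr fun t _ => ?_
      simp only [hg, hw]
      rw [← mul_assoc (cexp _), ← mul_assoc (cexp _), ← Complex.exp_add, ← Complex.exp_add]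
      congr 2
      push_cast
      linear_combination (-(n : ℂ) ^ 2) * hphase t
  simp only [hg, ellAmp, hcosh, hsinh] at hamp
  have e1 : (a : ℂ) * (a / c) = ((a ^ 2 / c : ℝ) : ℂ) := by push_cast; ring
  have e2 : (b : ℂ) * (b / c * I) = I * ((b ^ 2 / c : ℝ) : ℂ) := by push_cast; ring
  have hp : (((a ^ 2 / c : ℝ) : ℂ), I * ((b ^ 2 / c : ℝ) : ℂ)) ∈ Ω := by
    have : ((a : ℂ) * cos (s₀ * I), (b : ℂ) * sin (s₀ * I)) ∈ Ω := hs₀N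
    rwa [hcosh, hsinh, e1, e2] at this
  have hcomm := partials_comm (hUan _ hp)
  have hhelm := hHelm _ hp
  simp only at hcomm hhelm
  simp only [e1, e2, hcomm] at hamp
  have hamp := (mul_eq_zero.1 hamp).resolve_left (Complex.exp_ne_zero _)
  have hfac : (a * b / c * k ^ 2 * (q - 1) : ℂ) *
      U ((a ^ 2 / c : ℝ) : ℂ) (I * ((b ^ 2 / c : ℝ) : ℂ)) = 0 := by
    generalize ((a ^ 2 / c : ℝ) : ℂ) = z₁, I * ((b ^ 2 / c : ℝ) : ℂ) = z₂ at hamp hhelm ⊢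
    push_cast at hamp
    linear_combination hamp - a * b / c * hhelm + a * b / c * (k ^ 2 * q * U z₁ z₂ / 2 +
      P1 (P1 U) z₁ z₂ + P2 (P2 U) z₁ z₂ - I * P2 (P1 U) z₁ z₂) * I_sq
  refine (mul_eq_zero.1 hfac).resolve_left ?_
  have hq' : (q : ℂ) - 1 ≠ 0 := sub_ne_zero.2 (by exact_mod_cast hq1)
  have := ofReal_ne_zero.2 ha.ne'
  have := ofReal_ne_zero.2 hb.ne'
  have := ofReal_ne_zero.2 hk.ne'
  positivity
end
end

section
/- Let a > b > 0 and define g : ℂ → ℂ by g(t) = a·cos t + i·b·sin t, and let t₀ = i·artanh(b/a) = (i/2)·ln((a+b)/(a−b)). Then: (i) the zero set of g' in ℂ is exactly {t₀ + πn : n ∈ ℤ}; (ii) g(t₀) = √(a²−b²); (iii) g''(t₀) = −√(a²−b²) ≠ 0, so t₀ is a simple critical point of g; (iv) (a·cos t₀, b·sin t₀) = ( a²/√(a²−b²), i·b²/√(a²−b²) ); (v) (−a·sin t₀, b·cos t₀) = (ab/√(a²−b²))·(−i, 1); (vi) for all real r, s one has Re g(r + i s) = cos r·( a·cosh s − b·sinh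 s ). -/
open Complex

noncomputable section

/-- The phase function of the ellipse: `g(t) = a cos t + i b sin t`. -/
def gEll (a b : ℝ) : ℂ → ℂ := fun t => (a : ℂ) * Complex.cos t + Complex.I * ((b : ℂ) * Complex.sin t)

lemma hasDerivAt_gEll (a b : ℝ) (t : ℂ) :
    HasDerivAt (gEll a b) (-(a : ℂ) * Complex.sin t + Complex.I * ((b : ℂ) * Complex.cos t)) t := by
  have h := ((Complex.hasDerivAt_cos t).const_mul (a : ℂ)).add
    (((Complex.hasDerivAt_sin t).const_mul (b : ℂ)).const_mul Complex.I)
  exact h.congr_deriv (by ring)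

lemma deriv_gEll (a b : ℝ) : deriv (gEll a b) = fun t =>
    -(a : ℂ) * Complex.sin t + Complex.I * ((b : ℂ) * Complex.cos t) :=
  funext fun t => (hasDerivAt_gEll a b t).deriv

lemma iteratedDeriv_two_gEll (a b : ℝ) (t : ℂ) : iteratedDeriv 2 (gEll a b) t = -gEll a b t := by
  rw [iteratedDeriv_succ, iteratedDeriv_one, deriv_gEll]
  have h := ((Complex.hasDerivAt_sin t).const_mul (-(a : ℂ))).add
    (((Complex.hasDerivAt_cos t).const_mul (b : ℂ)).const_mul Complex.I)
  refine h.deriv.trans ?_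
  simp only [gEll]
  ring

lemma re_gEll (a b r s : ℝ) : (gEll a b ((r : ℂ) + Complex.I * (s : ℂ))).re =
    Real.cos r * (a * Real.cosh s - b * Real.sinh s) := by
  rw [mul_comm Complex.I, gEll, Complex.cos_add_mul_I, Complex.sin_add_mul_I]
  simp only [← Complex.ofReal_cos, ← Complex.ofReal_sin, ← Complex.ofReal_cosh,
    ← Complex.ofReal_sinh]
  simp only [Complex.add_re, Complex.mul_re, Complex.mul_im, Complex.sub_re, Complex.sub_im,
    Complex.add_im, Complex.ofReal_re, Complex.ofReal_im, Complex.I_re, Complex.I_im]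
  ring

lemma half_log_eq_artanh {a b : ℝ} (hb : 0 < b) (hab : b < a) :
    Real.log ((a + b) / (a - b)) / 2 = Real.artanh (b / a) := by
  have ha : 0 < a := hb.trans hab
  have h1 : b / a < 1 := (div_lt_one ha).2 hab
  have h0 : 0 < b / a := div_pos hb ha
  rw [Real.artanh_eq_half_log ⟨by linarith, h1.le⟩]
  have h2 : (1 + b / a) / (1 - b / a) = (a + b) / (a - b) := by
    have := sub_pos.2 h1
    have := sub_pos.2 hab
    field_simp
  rw [h2]
  ring

lemma sqrt_one_sub_div_sq {a b : ℝ} (ha : 0 < a) :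
    √(1 - (b / a) ^ 2) = √(a ^ 2 - b ^ 2) / a := by
  rw [show 1 - (b / a) ^ 2 = (a ^ 2 - b ^ 2) / a ^ 2 by field_simp,
    Real.sqrt_div' _ (sq_nonneg a), Real.sqrt_sq ha.le]

theorem stmt4 (a b : ℝ) (hb : 0 < b) (hab : b < a)
    (t₀ : ℂ) (ht₀ : t₀ = (Complex.I / 2) * ((Real.log ((a + b) / (a - b)) : ℝ) : ℂ)) :
    ({t : ℂ | deriv (gEll a b) t = 0} = {t : ℂ | ∃ n : ℤ, t = t₀ + (Real.pi : ℂ) * (n : ℂ)}) ∧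
    gEll a b t₀ = ((Real.sqrt (a ^ 2 - b ^ 2) : ℝ) : ℂ) ∧
    iteratedDeriv 2 (gEll a b) t₀ = -((Real.sqrt (a ^ 2 - b ^ 2) : ℝ) : ℂ) ∧
    iteratedDeriv 2 (gEll a b) t₀ ≠ 0 ∧
    (a : ℂ) * Complex.cos t₀ = ((a ^ 2 / Real.sqrt (a ^ 2 - b ^ 2) : ℝ) : ℂ) ∧
    (b : ℂ) * Complex.sin t₀ = Complex.I * ((b ^ 2 / Real.sqrt (a ^ 2 - b ^ 2) : ℝ) : ℂ) ∧
    -(a : ℂ) * Complex.sin t₀ = ((a * b / Real.sqrt (a ^ 2 - b ^ 2) : ℝ) : ℂ) * (-Complex.I) ∧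
    (b : ℂ) * Complex.cos t₀ = ((a * b / Real.sqrt (a ^ 2 - b ^ 2) : ℝ) : ℂ) * 1 ∧
    (∀ r s : ℝ, (gEll a b ((r : ℂ) + Complex.I * (s : ℂ))).re =
      Real.cos r * (a * Real.cosh s - b * Real.sinh s)) := by
  have ha : 0 < a := hb.trans hab
  have hpos : 0 < a ^ 2 - b ^ 2 := by nlinarith
  have hmem : b / a ∈ Set.Ioo (-1 : ℝ) 1 :=
    ⟨by linarith [div_pos hb ha], (div_lt_one ha).2 hab⟩
  have ht : t₀ = (Real.artanh (b / a) : ℂ) * Complex.I := by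
    rw [ht₀, ← half_log_eq_artanh hb hab]
    push_cast
    ring
  set c := √(a ^ 2 - b ^ 2) with hc
  have hc0 : (c : ℂ) ≠ 0 := Complex.ofReal_ne_zero.2 (Real.sqrt_pos.2 hpos).ne'
  have hcsq : (c : ℂ) ^ 2 = (a : ℂ) ^ 2 - (b : ℂ) ^ 2 := by
    exact_mod_cast Real.sq_sqrt hpos.le
  have haC : (a : ℂ) ≠ 0 := Complex.ofReal_ne_zero.2 ha.ne'
  have hcos : Complex.cos t₀ = (a : ℂ) / c := by
    rw [ht, Complex.cos_mul_I, ← Complex.ofReal_cosh, Real.cosh_artanh hmem,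
      sqrt_one_sub_div_sq ha, ← hc]
    push_cast
    field_simp
  have hsin : Complex.sin t₀ = Complex.I * ((b : ℂ) / c) := by
    rw [ht, Complex.sin_mul_I, ← Complex.ofReal_sinh, Real.sinh_artanh hmem,
      sqrt_one_sub_div_sq ha, ← hc]
    push_cast
    field_simp
  have hg : gEll a b t₀ = c := by
    rw [gEll, hcos, hsin]
    field_simp
    linear_combination (b : ℂ) ^ 2 * Complex.I_sq - hcsq
  have hg' (t : ℂ) : deriv (gEll a b) t = -(c : ℂ) * Complex.sin (t - t₀) := by
    rw [deriv_gEll, Complex.sin_sub, hcos, hsin]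
    field_simp
    ring
  have hg'' : iteratedDeriv 2 (gEll a b) t₀ = -(c : ℂ) := by
    rw [iteratedDeriv_two_gEll, hg]
  refine ⟨?_, hg, hg'', ?_, ?_, ?_, ?_, ?_, re_gEll a b⟩
  · ext t
    simp only [Set.mem_ofPred_eq, hg', mul_eq_zero, neg_eq_zero, hc0, false_or,
      Complex.sin_eq_zero_iff, sub_eq_iff_eq_add', mul_comm (Real.pi : ℂ)]
  · rw [hg'']
    exact neg_ne_zero.2 hc0
  · rw [hcos]
    push_cast
    ring
  · rw [hsin]
    push_cast
    ring
  · rw [hsin]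
    push_cast
    ring
  · rw [hcos]
    push_cast
    ring
end
end
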